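/- (L¹ and L^∞ bounds.) Let T > 0, let φ : ℝ → ℝ be continuous and nondecreasing, let μ be a Lévy measure on ℝ^N \ {0}, and let u₀ ∈ L^∞(ℝ^N) ∩ L¹(ℝ^N). Let u be a distributional solution in L^∞(Q_T) ∩ L¹(Q_T) ∩ C([0,T]; L¹_loc(ℝ^N)) of ∂_t u − L^μ[φ(u)] = 0 in Q_T with initial datum u₀. Then for every t ∈ [0,T], ‖u(·,t)‖_{L¹(ℝ^N)} ≤ ‖u₀‖_{L¹(ℝ^N)} and ‖u(·,t)‖_{L^∞(ℝ^N)} ≤ ‖u₀‖_{L^∞(ℝ^N)}. -/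

import Mathlib

open MeasureTheory Set Filter

noncomputable section

/-- Euclidean space `ℝ^N`. -/
abbrev Euc (N : ℕ) := EuclideanSpace ℝ (Fin N)

variable {N : ℕ}

/-- `μ` is a (symmetric) Lévy measure on `ℝ^N ∖ {0}` : it is a nonnegative measure giving no
mass to `{0}`, symmetric (`μ(−B) = μ(B)`), and `∫ min(|z|²,1) dμ(z) < ∞`. -/
def IsLevyMeasure (μ : Measure (Euc N)) : Prop :=
  μ {0} = 0 ∧ μ.map (fun z => -z) = μ ∧
    ∫⁻ z, ENNReal.ofReal (min (‖z‖ ^ 2) 1) ∂μ ≠ ⊤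

/-- The nonlocal operator
`L^μ[ψ](x) = ∫ (ψ(x+z) − ψ(x) − z·Dψ(x) 1_{|z|≤1}) dμ(z)`. -/
def Lop (μ : Measure (Euc N)) (ψ : Euc N → ℝ) (x : Euc N) : ℝ :=
  ∫ z, (ψ (x + z) - ψ x - (if ‖z‖ ≤ 1 then fderiv ℝ ψ x z else 0)) ∂μ

/-- `ψ ∈ C_c^∞(ℝ^N)`. -/
def IsTestFn (ψ : Euc N → ℝ) : Prop :=
  ContDiff ℝ (⊤ : ℕ∞) ψ ∧ HasCompactSupport ψ

/-- `ψ ∈ C_c^∞(ℝ^N × [0,T))` : smooth, compactly supported, and the support stays away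
from `t = T` (but may touch `t = 0`). -/
def IsSTTestFn (T : ℝ) (ψ : Euc N → ℝ → ℝ) : Prop :=
  ContDiff ℝ (⊤ : ℕ∞) (Function.uncurry ψ) ∧ HasCompactSupport (Function.uncurry ψ) ∧
    tsupport (Function.uncurry ψ) ⊆ {p : Euc N × ℝ | p.2 < T}

/-- `ψ ∈ C_c^∞(Q_T)` : smooth, compactly supported inside the open cylinder
`ℝ^N × (0,T)`. -/
def IsIntTestFn (T : ℝ) (ψ : Euc N → ℝ → ℝ) : Prop :=
  ContDiff ℝ (⊤ : ℕ∞) (Function.uncurry ψ) ∧ HasCompactSupport (Function.uncurry ψ) ∧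
    tsupport (Function.uncurry ψ) ⊆ {p : Euc N × ℝ | 0 < p.2 ∧ p.2 < T}

/-- The natural measure on the cylinder `Q_T = ℝ^N × (0,T)`. -/
def QTvol (N : ℕ) (T : ℝ) : Measure (Euc N × ℝ) :=
  (volume : Measure (Euc N)).prod ((volume : Measure ℝ).restrict (Ioo 0 T))

/-- `u ∈ L^∞(Q_T)`. -/
def MemLinfQT (T : ℝ) (u : Euc N → ℝ → ℝ) : Prop :=
  AEStronglyMeasurable (fun p : Euc N × ℝ => u p.1 p.2) (QTvol N T) ∧
    ∃ C : ℝ, ∀ᵐ p ∂(QTvol N T), |u p.1 p.2| ≤ C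

/-- `u ∈ L¹(Q_T)`. -/
def MemL1QT (T : ℝ) (u : Euc N → ℝ → ℝ) : Prop :=
  Integrable (fun p : Euc N × ℝ => u p.1 p.2) (QTvol N T)

/-- `u ∈ C([0,T]; L¹_loc(ℝ^N))` : for every compact `K`, `t ↦ u(·,t)` is continuous
from `[0,T]` into `L¹(K)`. -/
def MemCL1loc (T : ℝ) (u : Euc N → ℝ → ℝ) : Prop :=
  ∀ K : Set (Euc N), IsCompact K →
    (∀ t ∈ Icc (0 : ℝ) T, IntegrableOn (fun x => u x t) K) ∧
    ∀ t ∈ Icc (0 : ℝ) T,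
      Tendsto (fun s => ∫ x in K, |u x s - u x t|) (nhdsWithin t (Icc 0 T)) (nhds 0)

/-- `u` is a distributional solution of `∂_t u − A[φ(u)] = 0` in `Q_T` with initial
datum `u0` : for all `ψ ∈ C_c^∞(ℝ^N × [0,T))`,
`∫₀^T ∫ (u ∂_t ψ + φ(u) A[ψ(·,t)]) dx dt + ∫ u0(x) ψ(x,0) dx = 0`. -/
def IsDistSolOp (T : ℝ) (A : (Euc N → ℝ) → Euc N → ℝ) (φ : ℝ → ℝ)
    (u0 : Euc N → ℝ) (u : Euc N → ℝ → ℝ) : Prop :=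
  ∀ ψ : Euc N → ℝ → ℝ, IsSTTestFn T ψ →
    (∫ t in Ioo (0 : ℝ) T, ∫ x,
        (u x t * deriv (ψ x) t + φ (u x t) * A (fun y => ψ y t) x))
      + ∫ x, u0 x * ψ x 0 = 0

/-- `u0 ∈ L^∞(ℝ^N)`. -/
def MemLinfRn (u0 : Euc N → ℝ) : Prop :=
  AEStronglyMeasurable u0 (volume : Measure (Euc N)) ∧
    ∃ C : ℝ, ∀ᵐ x : Euc N ∂volume, |u0 x| ≤ C

end

/-- The symmetric second difference `f(x+z) + f(x-z) - 2 f(x)`. -/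
def secondDiff {N : ℕ} (f : Euc N → ℝ) (x z : Euc N) : ℝ := f (x + z) + f (x - z) - 2 * f x

/-- The nonlocal operator written with symmetric second differences. -/
noncomputable def symLevy {N : ℕ} (ν : Measure (Euc N)) (f : Euc N → ℝ) (x : Euc N) : ℝ :=
  1 / 2 * ∫ z, secondDiff f x z ∂ν

/-- The total mass `∫∫ |f(x+z) + f(x-z) - 2 f(x)| dx dν(z)`. -/
noncomputable def levyMass {N : ℕ} (ν : Measure (Euc N)) (f : Euc N → ℝ) : ENNReal :=
  ∫⁻ z, ∫⁻ x, ‖secondDiff f x z‖ₑ ∂volume ∂ν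

section SymLevy

variable {N : ℕ} {ν : Measure (Euc N)} {f g : Euc N → ℝ}

lemma continuous_secondDiff (hf : Continuous f) :
    Continuous (fun p : Euc N × Euc N => secondDiff f p.1 p.2) := by
  unfold secondDiff; fun_prop

lemma integrable_secondDiff [SFinite ν] (hf : Continuous f) (h : levyMass ν f ≠ ⊤) :
    Integrable (fun p : Euc N × Euc N => secondDiff f p.1 p.2)
      ((volume : Measure (Euc N)).prod ν) := by
  refine ⟨(continuous_secondDiff hf).aestronglyMeasurable, ?_⟩
  rw [hasFiniteIntegral_iff_enorm,
    lintegral_prod_symm _ (continuous_secondDiff hf).measurable.enorm.aemeasurable]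
  exact lt_top_iff_ne_top.2 h

lemma integrable_symLevy [SFinite ν] (hf : Continuous f) (h : levyMass ν f ≠ ⊤) :
    Integrable (symLevy ν f) :=
  (integrable_secondDiff hf h).integral_prod_left.const_mul _

lemma integral_secondDiff (hf : Integrable f) (z : Euc N) :
    ∫ x, secondDiff f x z = 0 := by
  have h : Integrable (fun x => f (x + z) + f (x - z)) :=
    (hf.comp_add_right z).add (hf.comp_sub_right z)
  unfold secondDiff
  rw [integral_sub h (hf.const_mul 2),
    integral_add (hf.comp_add_right z) (hf.comp_sub_right z),
    integral_add_right_eq_self f z, integral_sub_right_eq_self f z, integral_const_mul]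
  ring

lemma integral_symLevy [SFinite ν] (hf : Continuous f) (hfi : Integrable f)
    (h : levyMass ν f ≠ ⊤) : ∫ x, symLevy ν f x = 0 := by
  unfold symLevy
  rw [integral_const_mul, integral_integral_swap (integrable_secondDiff hf h)]
  simp [integral_secondDiff hfi]

lemma lintegral_enorm_symLevy_le [SFinite ν] (hf : Continuous f) :
    ∫⁻ x, ‖symLevy ν f x‖ₑ ≤ levyMass ν f := by
  have hm := (continuous_secondDiff hf).measurable.enorm
  calc ∫⁻ x, ‖symLevy ν f x‖ₑ ≤ ∫⁻ x, ∫⁻ z, ‖secondDiff f x z‖ₑ ∂ν := by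
        refine lintegral_mono fun x => ?_
        unfold symLevy
        rw [enorm_mul]
        calc _ ≤ 1 * ∫⁻ z, ‖secondDiff f x z‖ₑ ∂ν := by
              gcongr
              · rw [← ofReal_norm]
                norm_num
              · exact enorm_integral_le_lintegral_enorm _
          _ = _ := one_mul _
    _ = levyMass ν f := lintegral_lintegral_swap hm.aemeasurable

lemma lintegral_enorm_secondDiff_le (hf : Continuous f) (z : Euc N) :
    ∫⁻ x, ‖secondDiff f x z‖ₑ ≤ 4 * ∫⁻ x, ‖f x‖ₑ := by
  have hm : Measurable f := hf.measurable
  calc ∫⁻ x, ‖secondDiff f x z‖ₑ ≤ ∫⁻ x, (‖f (x + z)‖ₑ + ‖f (x - z)‖ₑ + 2 * ‖f x‖ₑ) := by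
        refine lintegral_mono fun x => ?_
        refine (enorm_sub_le).trans (add_le_add (enorm_add_le _ _) ?_)
        rw [enorm_mul]
        gcongr
        rw [← ofReal_norm]
        norm_num
    _ = _ := by
        rw [lintegral_add_left (by fun_prop), lintegral_add_left (by fun_prop),
          lintegral_const_mul _ (by fun_prop), lintegral_add_right_eq_self (fun x => ‖f x‖ₑ) z,
          lintegral_sub_right_eq_self (fun x => ‖f x‖ₑ) z]
        ring

lemma levyMass_ne_top [IsFiniteMeasure ν] (hf : Continuous f) (hfi : Integrable f) :
    levyMass ν f ≠ ⊤ := by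
  refine ne_top_of_le_ne_top ?_ (lintegral_mono fun z => lintegral_enorm_secondDiff_le hf z)
  rw [lintegral_const]
  exact ENNReal.mul_ne_top (ENNReal.mul_ne_top (by norm_num) hfi.2.ne) (measure_ne_top _ _)

lemma integrable_of_continuous_hasCompactSupport (hf : Continuous f) (hc : HasCompactSupport f) :
    Integrable f := hf.integrable_of_hasCompactSupport hc

lemma exists_abs_le (hf : Continuous f) (hc : HasCompactSupport f) :
    ∃ B, 0 ≤ B ∧ ∀ x, |f x| ≤ B := by
  obtain ⟨B, hB⟩ := hc.exists_bound_of_continuous hf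
  exact ⟨B, (norm_nonneg _).trans (hB 0), hB⟩

lemma abs_secondDiff_le {B : ℝ} (hB : ∀ x, |f x| ≤ B) (x z : Euc N) :
    |secondDiff f x z| ≤ 4 * B := by
  have h1 := abs_le.1 (hB (x + z))
  have h2 := abs_le.1 (hB (x - z))
  have h3 := abs_le.1 (hB x)
  unfold secondDiff
  rw [abs_le]
  constructor <;> linarith

lemma integrable_secondDiff_right [IsFiniteMeasure ν] (hf : Continuous f) {B : ℝ}
    (hB : ∀ x, |f x| ≤ B) (x : Euc N) : Integrable (secondDiff f x) ν :=
  Integrable.of_bound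
    ((continuous_secondDiff hf).comp (Continuous.prodMk_right x)).aestronglyMeasurable (4 * B)
    (ae_of_all _ fun z => abs_secondDiff_le hB x z)

lemma continuous_symLevy [IsFiniteMeasure ν] (hf : Continuous f) (hc : HasCompactSupport f) :
    Continuous (symLevy ν f) := by
  obtain ⟨B, -, hB⟩ := exists_abs_le hf hc
  refine continuous_const.mul (continuous_of_dominated (bound := fun _ => 4 * B) ?_ ?_ ?_ ?_)
  · exact fun x => (integrable_secondDiff_right hf hB x).aestronglyMeasurable
  · exact fun x => ae_of_all _ fun z => abs_secondDiff_le hB x z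
  · exact integrable_const _
  · exact ae_of_all _ fun z => (continuous_secondDiff hf).comp (Continuous.prodMk_left z)

lemma hasCompactSupport_symLevy {R : ℝ} (hR : ∀ᵐ z ∂ν, ‖z‖ ≤ R) (hc : HasCompactSupport f) :
    HasCompactSupport (symLevy ν f) := by
  obtain ⟨r, hr⟩ := hc.isCompact.isBounded.subset_closedBall (0 : Euc N)
  refine HasCompactSupport.intro (isCompact_closedBall (0 : Euc N) (r + |R|)) fun x hx => ?_
  have hz : ∀ y : Euc N, r < ‖y‖ → f y = 0 := fun y hy => by
    by_contra h
    have := hr (subset_tsupport _ h)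
    rw [mem_closedBall_zero_iff] at this
    linarith
  rw [mem_closedBall_zero_iff, not_le] at hx
  unfold symLevy
  rw [integral_eq_zero_of_ae, mul_zero]
  filter_upwards [hR] with z hzR
  have hzR' : ‖z‖ ≤ |R| := hzR.trans (le_abs_self R)
  have h1 := norm_sub_norm_le x z
  have h2 : ‖x‖ ≤ ‖x + z‖ + ‖z‖ := by simpa using norm_sub_le (x + z) z
  have h0 := abs_nonneg R
  unfold secondDiff
  rw [hz _ (by linarith), hz _ (by linarith), hz _ (by linarith)]
  simp

lemma integral_mul_symLevy [IsFiniteMeasure ν] (hf : Continuous f) (hcf : HasCompactSupport f)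
    (hg : Continuous g) (hcg : HasCompactSupport g) :
    ∫ x, g x * symLevy ν f x = 1 / 2 * ∫ z, ∫ x, g x * secondDiff f x z ∂volume ∂ν := by
  obtain ⟨B, -, hB⟩ := exists_abs_le hg hcg
  have hi := integrable_secondDiff (ν := ν) hf
    (levyMass_ne_top hf (integrable_of_continuous_hasCompactSupport hf hcf))
  have hi' : Integrable (fun p : Euc N × Euc N => g p.1 * secondDiff f p.1 p.2)
      ((volume : Measure (Euc N)).prod ν) :=
    hi.bdd_mul (c := B) (hg.comp continuous_fst).aestronglyMeasurable (ae_of_all _ fun p => hB p.1)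
  rw [← integral_integral_swap hi', ← integral_const_mul]
  refine integral_congr_ae (ae_of_all _ fun x => ?_)
  simp only [symLevy, integral_const_mul]
  ring

lemma integrable_mul_comp (hf : Continuous f) (hcf : HasCompactSupport f) (hg : Continuous g)
    {e : Euc N → Euc N} (he : Continuous e) : Integrable (fun x => f x * g (e x)) :=
  (hf.mul (hg.comp he)).integrable_of_hasCompactSupport hcf.mul_right

lemma integral_mul_secondDiff (hf : Continuous f) (hg : Continuous g) (hcg : HasCompactSupport g)
    (z : Euc N) :
    ∫ x, g x * secondDiff f x z
      = (∫ x, g x * f (x + z)) + (∫ x, g x * f (x - z)) - 2 * ∫ x, g x * f x := by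
  have h1 := integrable_mul_comp hg hcg hf (e := fun x => x + z) (by fun_prop)
  have h2 := integrable_mul_comp hg hcg hf (e := fun x => x - z) (by fun_prop)
  have h3 := integrable_mul_comp hg hcg hf (e := fun x => x) (by fun_prop)
  have h12 : Integrable (fun x => g x * f (x + z) + g x * f (x - z)) := h1.add h2
  rw [← integral_const_mul, ← integral_add h1 h2, ← integral_sub h12 (h3.const_mul 2)]
  refine integral_congr_ae (ae_of_all _ fun x => ?_)
  simp only [secondDiff]
  ring

lemma integral_mul_symLevy_comm [IsFiniteMeasure ν] (hf : Continuous f)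
    (hcf : HasCompactSupport f) (hg : Continuous g) (hcg : HasCompactSupport g) :
    ∫ x, g x * symLevy ν f x = ∫ x, f x * symLevy ν g x := by
  rw [integral_mul_symLevy hf hcf hg hcg, integral_mul_symLevy hg hcg hf hcf]
  congr 2
  ext z
  rw [integral_mul_secondDiff hf hg hcg, integral_mul_secondDiff hg hf hcf]
  have e1 : ∫ x, g x * f (x + z) = ∫ x, f x * g (x - z) := by
    rw [← integral_sub_right_eq_self (fun x => g x * f (x + z)) z]
    simp [mul_comm]
  have e2 : ∫ x, g x * f (x - z) = ∫ x, f x * g (x + z) := by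
    rw [← integral_add_right_eq_self (fun x => g x * f (x - z)) z]
    simp [mul_comm]
  have e3 : ∫ x, g x * f x = ∫ x, f x * g x := by simp [mul_comm]
  rw [e1, e2, e3]
  ring

lemma abs_integral_mul_comp_le (hf : Continuous f) (hcf : HasCompactSupport f) (z : Euc N) :
    |∫ x, f x * f (x + z)| ≤ ∫ x, f x ^ 2 := by
  have h2 : Integrable (fun x => f x ^ 2) :=
    (hf.pow 2).integrable_of_hasCompactSupport (by simpa only [pow_two] using hcf.mul_right)
  have hz := h2.comp_add_right z
  calc |∫ x, f x * f (x + z)| ≤ ∫ x, |f x * f (x + z)| := abs_integral_le_integral_abs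
    _ ≤ ∫ x, (1 / 2 * f x ^ 2 + 1 / 2 * f (x + z) ^ 2) := by
        refine integral_mono_of_nonneg (ae_of_all _ fun x => abs_nonneg _)
          ((h2.const_mul _).add (hz.const_mul _)) (ae_of_all _ fun x => ?_)
        show |f x * f (x + z)| ≤ 1 / 2 * f x ^ 2 + 1 / 2 * f (x + z) ^ 2
        rw [abs_mul, ← sq_abs (f x), ← sq_abs (f (x + z))]
        nlinarith [sq_nonneg (|f x| - |f (x + z)|)]
    _ = _ := by
        rw [integral_add (h2.const_mul _) (hz.const_mul _), integral_const_mul, integral_const_mul,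
          integral_add_right_eq_self (fun x => f x ^ 2) z]
        ring

lemma integral_mul_secondDiff_self_mem (hf : Continuous f) (hcf : HasCompactSupport f)
    (z : Euc N) : ∫ x, f x * secondDiff f x z ∈ Icc (-4 * ∫ x, f x ^ 2) 0 := by
  have h1 := abs_le.1 (abs_integral_mul_comp_le hf hcf z)
  have h2 := abs_le.1 (abs_integral_mul_comp_le hf hcf (-z))
  have h3 : ∫ x, f x * f x = ∫ x, f x ^ 2 := by simp [pow_two]
  rw [integral_mul_secondDiff hf hf hcf, h3]
  simp only [← sub_eq_add_neg] at h2
  constructor <;> linarith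

lemma integral_mul_symLevy_self_nonpos [IsFiniteMeasure ν] (hf : Continuous f)
    (hcf : HasCompactSupport f) : ∫ x, f x * symLevy ν f x ≤ 0 := by
  rw [integral_mul_symLevy hf hcf hf hcf]
  have := integral_nonpos (μ := ν) fun z => (integral_mul_secondDiff_self_mem hf hcf z).2
  linarith

lemma le_integral_mul_symLevy_self [IsFiniteMeasure ν] (hf : Continuous f)
    (hcf : HasCompactSupport f) :
    -2 * ν.real univ * ∫ x, f x ^ 2 ≤ ∫ x, f x * symLevy ν f x := by
  rw [integral_mul_symLevy hf hcf hf hcf]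
  have h0 : 0 ≤ ∫ x, f x ^ 2 := integral_nonneg fun x => sq_nonneg _
  have := norm_integral_le_of_norm_le_const (μ := ν) (C := 4 * ∫ x, f x ^ 2)
    (f := fun z => ∫ x, f x * secondDiff f x z) (ae_of_all _ fun z => by
      have := integral_mul_secondDiff_self_mem hf hcf z
      rw [Real.norm_eq_abs, abs_le]
      constructor <;> linarith [this.1, this.2])
  rw [Real.norm_eq_abs, abs_le] at this
  linarith [this.1]

lemma symLevy_le [IsFiniteMeasure ν] (hf : Continuous f) (hcf : HasCompactSupport f) {B : ℝ}
    (hB : ∀ x, f x ≤ B) (x : Euc N) : symLevy ν f x ≤ ν.real univ * (B - f x) := by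
  obtain ⟨M, -, hM⟩ := exists_abs_le hf hcf
  have : ∫ z, secondDiff f x z ∂ν ≤ ∫ _, 2 * (B - f x) ∂ν :=
    integral_mono (integrable_secondDiff_right hf hM x) (integrable_const _) fun z => by
      unfold secondDiff
      linarith [hB (x + z), hB (x - z)]
  rw [integral_const, smul_eq_mul] at this
  unfold symLevy
  linarith

lemma symLevy_neg (ν : Measure (Euc N)) (f : Euc N → ℝ) (x : Euc N) :
    symLevy ν (fun y => -f y) x = -symLevy ν f x := by
  unfold symLevy
  rw [← mul_neg, ← integral_neg]
  congr 2
  ext z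
  unfold secondDiff
  ring

lemma le_symLevy [IsFiniteMeasure ν] (hf : Continuous f) (hcf : HasCompactSupport f) {B : ℝ}
    (hB : ∀ x, B ≤ f x) (x : Euc N) : ν.real univ * (B - f x) ≤ symLevy ν f x := by
  have := symLevy_le (ν := ν) hf.neg hcf.neg (B := -B) (fun x => neg_le_neg (hB x)) x
  have h2 := symLevy_neg ν f x
  simp only [Pi.neg_apply] at this
  have h3 : symLevy ν (-f) x = symLevy ν (fun y => -f y) x := rfl
  rw [h3, h2] at this
  linarith

lemma symLevy_add_const_mul [IsFiniteMeasure ν] (hf : Continuous f) (hcf : HasCompactSupport f)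
    (hg : Continuous g) (hcg : HasCompactSupport g) (c : ℝ) (x : Euc N) :
    symLevy ν (fun y => f y + c * g y) x = symLevy ν f x + c * symLevy ν g x := by
  obtain ⟨M, -, hM⟩ := exists_abs_le hf hcf
  obtain ⟨M', -, hM'⟩ := exists_abs_le hg hcg
  have h1 := integrable_secondDiff_right (ν := ν) hf hM x
  have h2 := integrable_secondDiff_right (ν := ν) hg hM' x
  unfold symLevy
  have : ∀ z, secondDiff (fun y => f y + c * g y) x z = secondDiff f x z + c * secondDiff g x z :=
    fun z => by unfold secondDiff; ring
  simp only [this]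
  rw [integral_add h1 (h2.const_mul c), integral_const_mul]
  ring

/-- `L¹` contraction of an explicit Euler step for `∂_t f = L[a f]`. -/
lemma integral_abs_add_symLevy_le [IsFiniteMeasure ν] (hf : Continuous f)
    (hcf : HasCompactSupport f) {a : Euc N → ℝ}
    (ha : Continuous a) (ha0 : ∀ x, 0 ≤ a x) {h : ℝ} (hh : 0 ≤ h)
    (hcfl : ∀ x, h * a x * ν.real univ ≤ 1) :
    ∫ x, |f x + h * symLevy ν (fun y => a y * f y) x| ≤ ∫ x, |f x| := by
  have hp : Continuous (fun y => a y * f y) := ha.mul hf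
  have hcp : HasCompactSupport (fun y => a y * f y) := hcf.mul_left
  have hq : Continuous (fun y => a y * |f y|) := ha.mul hf.abs
  have hcq : HasCompactSupport (fun y => a y * |f y|) :=
    HasCompactSupport.mul_left (hcf.comp_left abs_zero)
  have hfa : Integrable (fun x => |f x|) := (integrable_of_continuous_hasCompactSupport hf hcf).abs
  have hqi := integrable_of_continuous_hasCompactSupport hq hcq
  have hLi := integrable_symLevy (ν := ν) hq (levyMass_ne_top hq hqi)
  obtain ⟨M, -, hM⟩ := exists_abs_le hp hcp
  obtain ⟨M', -, hM'⟩ := exists_abs_le hq hcq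
  have key : ∀ x, |f x + h * symLevy ν (fun y => a y * f y) x|
      ≤ |f x| + h * symLevy ν (fun y => a y * |f y|) x := fun x => by
    have h1 : ∀ σ : ℝ, |σ| = 1 → σ * symLevy ν (fun y => a y * f y) x
        ≤ symLevy ν (fun y => a y * |f y|) x + ν.real univ * a x * (|f x| - σ * f x) :=
      fun σ hσ => by
        have hUφ : ∫ z, σ * secondDiff (fun y => a y * f y) x z ∂ν
            ≤ ∫ z, (secondDiff (fun y => a y * |f y|) x z + 2 * (a x * (|f x| - σ * f x))) ∂ν := by
          refine integral_mono ((integrable_secondDiff_right hp hM x).const_mul σ)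
            ((integrable_secondDiff_right hq hM' x).add (integrable_const _)) fun z => ?_
          have hs : ∀ y, σ * (a y * f y) ≤ a y * |f y| := fun y => by
            have : σ * f y ≤ |f y| := by
              calc σ * f y ≤ |σ * f y| := le_abs_self _
                _ = |f y| := by rw [abs_mul, hσ, one_mul]
            nlinarith [ha0 y]
          have := hs (x + z)
          have := hs (x - z)
          simp only [secondDiff]
          linarith
        rw [integral_const_mul, integral_add (integrable_secondDiff_right hq hM' x)
          (integrable_const _), integral_const, smul_eq_mul] at hUφ
        unfold symLevy
        linarith
    have hc := hcfl x
    rcases abs_cases (f x + h * symLevy ν (fun y => a y * f y) x) with ⟨e, -⟩ | ⟨e, -⟩ <;> rw [e]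
    · have := mul_le_mul_of_nonneg_left (h1 1 (by simp)) hh
      have h4 : 0 ≤ |f x| - f x := sub_nonneg.2 (le_abs_self _)
      nlinarith
    · have := mul_le_mul_of_nonneg_left (h1 (-1) (by simp)) hh
      have h4 : 0 ≤ |f x| + f x := by linarith [neg_abs_le (f x)]
      nlinarith
  calc _ ≤ ∫ x, (|f x| + h * symLevy ν (fun y => a y * |f y|) x) :=
        integral_mono_of_nonneg (ae_of_all _ fun x => abs_nonneg _) (hfa.add (hLi.const_mul h))
          (ae_of_all _ key)
    _ = ∫ x, |f x| := by
        rw [integral_add hfa (hLi.const_mul h), integral_const_mul,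
          integral_symLevy hq hqi (levyMass_ne_top hq hqi)]
        ring

end SymLevy

section LevyMeasure

variable {N : ℕ} {μ : Measure (Euc N)} {f : Euc N → ℝ}

lemma IsLevyMeasure.sFinite (hμ : IsLevyMeasure μ) : SFinite μ := by
  have hm : Measurable (fun z : Euc N => ENNReal.ofReal (min (‖z‖ ^ 2) 1)) := by fun_prop
  have : IsFiniteMeasure (μ.withDensity fun z => ENNReal.ofReal (min (‖z‖ ^ 2) 1)) :=
    isFiniteMeasure_withDensity hμ.2.2
  have h0 : ∀ᵐ z ∂μ, ENNReal.ofReal (min (‖z‖ ^ 2) 1) ≠ 0 := by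
    have : ∀ᵐ z ∂μ, z ∈ ({0} : Set (Euc N))ᶜ := compl_mem_ae_iff.2 hμ.1
    filter_upwards [this] with z hz
    have : 0 < ‖z‖ := norm_pos_iff.2 hz
    simp only [ne_eq, ENNReal.ofReal_eq_zero, not_le]
    positivity
  rw [← withDensity_inv_same hm h0 (ae_of_all _ fun z => ENNReal.ofReal_ne_top)]
  infer_instance

lemma IsTestFn.continuous (hf : IsTestFn f) : Continuous f := hf.1.continuous

lemma IsTestFn.integrable (hf : IsTestFn f) : Integrable f :=
  hf.1.continuous.integrable_of_hasCompactSupport hf.2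

lemma IsTestFn.exists_taylor_bound (hf : IsTestFn f) :
    ∃ C, 0 ≤ C ∧ ∀ x z, |f (x + z) - f x - fderiv ℝ f x z| ≤ C * ‖z‖ ^ 2 := by
  have h1 : ContDiff ℝ 1 (fderiv ℝ f) := hf.1.fderiv_right (m := 1) (by norm_cast)
  obtain ⟨C, hC⟩ := h1.lipschitzWith_of_hasCompactSupport (hf.2.fderiv ℝ) (by simp)
  refine ⟨C, C.2, fun x z => ?_⟩
  have hd : Differentiable ℝ f := hf.1.differentiable (by simp)
  have := (convex_closedBall x ‖z‖).norm_image_sub_le_of_norm_fderiv_le'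
    (𝕜 := ℝ) (f := f) (φ := fderiv ℝ f x) (C := C * ‖z‖) (fun y _ => hd y) (fun y hy => by
      refine (hC.norm_sub_le y x).trans ?_
      gcongr
      exact mem_closedBall_iff_norm.1 hy)
    (Metric.mem_closedBall_self (norm_nonneg z)) (y := x + z) (by simp)
  simpa [pow_two, mul_assoc] using this

lemma IsTestFn.exists_abs_secondDiff_le (hf : IsTestFn f) :
    ∃ C, 0 ≤ C ∧ ∀ x z, |secondDiff f x z| ≤ C * min (‖z‖ ^ 2) 1 := by
  obtain ⟨C, hC0, hC⟩ := hf.exists_taylor_bound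
  obtain ⟨B, hB0, hB⟩ := exists_abs_le hf.continuous hf.2
  refine ⟨2 * C + 4 * B, by positivity, fun x z => ?_⟩
  rcases le_total (‖z‖ ^ 2) 1 with h | h
  · rw [min_eq_left h]
    have h1 := abs_le.1 (hC x z)
    have h2 := abs_le.1 (hC x (-z))
    have h3 : 0 ≤ B * ‖z‖ ^ 2 := by positivity
    simp only [map_neg, norm_neg, ← sub_eq_add_neg] at h2
    unfold secondDiff
    rw [abs_le]
    constructor <;> linarith [h1.1, h1.2, h2.1, h2.2]
  · rw [min_eq_right h]
    linarith [abs_secondDiff_le hB x z]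

lemma IsLevyMeasure.integrable_min (hμ : IsLevyMeasure μ) :
    Integrable (fun z : Euc N => min (‖z‖ ^ 2) 1) μ := by
  refine ⟨by fun_prop, ?_⟩
  rw [hasFiniteIntegral_iff_ofReal (ae_of_all _ fun z => by positivity)]
  exact lt_top_iff_ne_top.2 hμ.2.2

lemma IsTestFn.integrable_secondDiff_right (hf : IsTestFn f) (hμ : IsLevyMeasure μ)
    (x : Euc N) : Integrable (secondDiff f x) μ := by
  obtain ⟨C, hC0, hC⟩ := hf.exists_abs_secondDiff_le
  exact (hμ.integrable_min.const_mul C).mono'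
    ((continuous_secondDiff hf.continuous).comp (Continuous.prodMk_right x)).aestronglyMeasurable
    (ae_of_all _ fun z => hC x z)

lemma Lop_eq_symLevy (hf : IsTestFn f) (hμ : IsLevyMeasure μ) : Lop μ f = symLevy μ f := by
  ext x
  obtain ⟨C, hC0, hC⟩ := hf.exists_taylor_bound
  obtain ⟨B, hB0, hB⟩ := exists_abs_le hf.continuous hf.2
  set k : Euc N → ℝ := fun z => f (x + z) - f x - (if ‖z‖ ≤ 1 then fderiv ℝ f x z else 0) with hk
  have hfm : Measurable f := hf.continuous.measurable
  have hkm : Measurable k := by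
    refine Measurable.sub (by fun_prop) (Measurable.ite ?_ (by fun_prop) measurable_const)
    exact measurableSet_le measurable_norm measurable_const
  have hki : Integrable k μ := by
    refine (hμ.integrable_min.const_mul (C + 2 * B)).mono' hkm.aestronglyMeasurable
      (ae_of_all _ fun z => ?_)
    rw [Real.norm_eq_abs]
    by_cases h : ‖z‖ ≤ 1
    · have h2 : ‖z‖ ^ 2 ≤ 1 := pow_le_one₀ (norm_nonneg z) h
      have h3 : 0 ≤ B * ‖z‖ ^ 2 := by positivity
      simp only [hk, h, if_true, min_eq_left h2]
      linarith [hC x z]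
    · have h2 : 1 ≤ ‖z‖ ^ 2 := one_le_pow₀ (not_le.1 h).le
      have h1 := abs_le.1 (hB (x + z))
      have h3 := abs_le.1 (hB x)
      simp only [hk, h, if_false, min_eq_right h2, abs_le]
      constructor <;> linarith
  have hneg : MeasurePreserving (fun z : Euc N => -z) μ μ := ⟨measurable_neg, hμ.2.1⟩
  have hkn : Integrable (fun z => k (-z)) μ := hneg.integrable_comp_of_integrable hki
  have e : ∫ z, k (-z) ∂μ = ∫ z, k z ∂μ :=
    hneg.integral_comp (MeasurableEquiv.neg (Euc N)).measurableEmbedding k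
  have hs : ∀ z, secondDiff f x z = k z + k (-z) := fun z => by
    simp only [hk, secondDiff, norm_neg, map_neg, ← sub_eq_add_neg]
    split_ifs <;> ring
  show ∫ z, k z ∂μ = _
  unfold symLevy
  simp only [hs]
  rw [integral_add hki hkn, e]
  ring

lemma IsTestFn.exists_lintegral_secondDiff_le (hf : IsTestFn f) :
    ∃ C : ENNReal, C ≠ ⊤ ∧ ∀ z, ∫⁻ x, ‖secondDiff f x z‖ₑ
      ≤ C * ENNReal.ofReal (min (‖z‖ ^ 2) 1) := by
  obtain ⟨C, hC0, hC⟩ := hf.exists_abs_secondDiff_le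
  obtain ⟨r, hr⟩ := hf.2.isCompact.isBounded.subset_closedBall (0 : Euc N)
  have hz : ∀ y : Euc N, r < ‖y‖ → f y = 0 := fun y hy => by
    by_contra h
    have := hr (subset_tsupport _ h)
    rw [mem_closedBall_zero_iff] at this
    linarith
  refine ⟨ENNReal.ofReal C * volume (Metric.closedBall (0 : Euc N) (r + 1))
    + 4 * ∫⁻ x, ‖f x‖ₑ, ?_, fun z => ?_⟩
  · exact ENNReal.add_ne_top.2 ⟨ENNReal.mul_ne_top ENNReal.ofReal_ne_top
      measure_closedBall_lt_top.ne, ENNReal.mul_ne_top (by norm_num) hf.integrable.2.ne⟩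
  rcases le_total ‖z‖ 1 with h | h
  · calc ∫⁻ x, ‖secondDiff f x z‖ₑ
        ≤ ∫⁻ x, (Metric.closedBall (0 : Euc N) (r + 1)).indicator
            (fun _ => ENNReal.ofReal (C * min (‖z‖ ^ 2) 1)) x := by
          refine lintegral_mono fun x => ?_
          by_cases hx : x ∈ Metric.closedBall (0 : Euc N) (r + 1)
          · rw [indicator_of_mem hx, ← ofReal_norm]
            exact ENNReal.ofReal_le_ofReal (hC x z)
          · rw [mem_closedBall_zero_iff, not_le] at hx
            have h1 := norm_sub_norm_le x z
            have h2 : ‖x‖ ≤ ‖x + z‖ + ‖z‖ := by simpa using norm_sub_le (x + z) z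
            simp only [secondDiff]
            rw [hz _ (by linarith), hz _ (by linarith), hz _ (by linarith)]
            simp
      _ = ENNReal.ofReal C * volume (Metric.closedBall (0 : Euc N) (r + 1))
            * ENNReal.ofReal (min (‖z‖ ^ 2) 1) := by
          rw [lintegral_indicator_const measurableSet_closedBall, ENNReal.ofReal_mul hC0]
          ring
      _ ≤ _ := by gcongr; exact le_self_add
  · have h2 : 1 ≤ ‖z‖ ^ 2 := one_le_pow₀ h
    rw [min_eq_right h2, ENNReal.ofReal_one, mul_one]
    exact (lintegral_enorm_secondDiff_le hf.continuous z).trans le_add_self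

lemma IsTestFn.levyMass_ne_top (hf : IsTestFn f) (hμ : IsLevyMeasure μ) : levyMass μ f ≠ ⊤ := by
  obtain ⟨C, hC, h⟩ := hf.exists_lintegral_secondDiff_le
  refine ne_top_of_le_ne_top ?_ (lintegral_mono h)
  rw [lintegral_const_mul _ (by fun_prop)]
  exact ENNReal.mul_ne_top hC hμ.2.2

/-- A Lévy measure can be truncated to a bounded set away from the origin, where it is finite,
with arbitrarily small error. -/
lemma IsTestFn.exists_truncation (hf : IsTestFn f) (hμ : IsLevyMeasure μ) {r : ENNReal}
    (hr : 0 < r) : ∃ S : Set (Euc N), MeasurableSet S ∧ μ S ≠ ⊤ ∧ (∃ R, ∀ z ∈ S, ‖z‖ ≤ R) ∧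
      levyMass (μ.restrict Sᶜ) f ≤ r := by
  have := hμ.sFinite
  set S : ℕ → Set (Euc N) := fun n => {z | 1 / ((n : ℝ) + 1) ≤ ‖z‖ ∧ ‖z‖ ≤ n} with hS
  have hSm : ∀ n, MeasurableSet (S n) := fun n =>
    (measurableSet_le measurable_const measurable_norm).inter
      (measurableSet_le measurable_norm measurable_const)
  set G : Euc N → ENNReal := fun z => ∫⁻ x, ‖secondDiff f x z‖ₑ with hG
  have hGm : Measurable G :=
    (continuous_secondDiff hf.continuous).measurable.enorm.lintegral_prod_left'
  have hlim : Tendsto (fun n => ∫⁻ z, (S n)ᶜ.indicator G z ∂μ) atTop (nhds (∫⁻ _, 0 ∂μ)) := by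
    refine tendsto_lintegral_of_dominated_convergence G (fun n => hGm.indicator (hSm n).compl)
      (fun n => ae_of_all _ fun z => indicator_le_self _ _ _) (hf.levyMass_ne_top hμ) ?_
    have h0 : ∀ᵐ z ∂μ, z ∈ ({0} : Set (Euc N))ᶜ := compl_mem_ae_iff.2 hμ.1
    filter_upwards [h0] with z hz
    have hz' : 0 < ‖z‖ := norm_pos_iff.2 hz
    refine tendsto_const_nhds.congr' ?_
    obtain ⟨n1, hn1⟩ := exists_nat_one_div_lt hz'
    obtain ⟨n2, hn2⟩ := exists_nat_ge ‖z‖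
    filter_upwards [eventually_ge_atTop n1, eventually_ge_atTop n2] with n h1 h2
    have : z ∈ S n := by
      refine ⟨(one_div_le_one_div_of_le (by positivity) ?_).trans hn1.le, hn2.trans ?_⟩
      · exact_mod_cast Nat.succ_le_succ h1
      · exact_mod_cast h2
    rw [indicator_of_notMem (by simpa using this)]
  rw [lintegral_zero] at hlim
  obtain ⟨n, hn⟩ := (hlim.eventually (eventually_le_nhds hr)).exists
  refine ⟨S n, hSm n, ?_, ⟨n, fun z hz => hz.2⟩, ?_⟩
  · have hc : 0 < ENNReal.ofReal (min ((1 / ((n : ℝ) + 1)) ^ 2) 1) :=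
      ENNReal.ofReal_pos.2 (by positivity)
    refine ne_top_of_le_ne_top (ENNReal.div_ne_top hμ.2.2 hc.ne')
      ((measure_mono fun z hz => ?_).trans (meas_ge_le_lintegral_div (f := fun z : Euc N =>
        ENNReal.ofReal (min (‖z‖ ^ 2) 1)) (by fun_prop) hc.ne' ENNReal.ofReal_ne_top))
    refine ENNReal.ofReal_le_ofReal (min_le_min_right _ ?_)
    exact pow_le_pow_left₀ (by positivity) hz.1 2
  · unfold levyMass
    rw [← lintegral_indicator (hSm n).compl]
    exact hn

end LevyMeasure

/-- Mollification of `f` by the kernel `ρ`. -/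
noncomputable def mollify {N : ℕ} (ρ f : Euc N → ℝ) (x : Euc N) : ℝ := ∫ y, ρ y * f (x - y)

section Mollify

variable {N : ℕ} {μ ν : Measure (Euc N)} {ρ f g : Euc N → ℝ}

lemma mollify_eq_convolution (ρ f : Euc N → ℝ) :
    mollify ρ f = convolution ρ f (ContinuousLinearMap.lsmul ℝ ℝ) volume := rfl

lemma isTestFn_mollify (hρ : IsTestFn ρ) (hf : Continuous f) (hcf : HasCompactSupport f) :
    IsTestFn (mollify ρ f) := by
  rw [mollify_eq_convolution]
  exact ⟨hρ.2.contDiff_convolution_left _ hρ.1 hf.locallyIntegrable, hρ.2.convolution _ hcf⟩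

lemma integrable_mollify_integrand (hρ : IsTestFn ρ) (hf : Continuous f) (x : Euc N) :
    Integrable (fun y => ρ y * f (x - y)) :=
  integrable_mul_comp hρ.continuous hρ.2 hf (by fun_prop)

lemma mollify_add_const_mul (hρ : IsTestFn ρ) (hf : Continuous f) (hg : Continuous g) (c : ℝ)
    (x : Euc N) : mollify ρ (fun y => f y + c * g y) x = mollify ρ f x + c * mollify ρ g x := by
  unfold mollify
  rw [← integral_const_mul, ← integral_add (integrable_mollify_integrand hρ hf x)
    ((integrable_mollify_integrand hρ hg x).const_mul c)]
  refine integral_congr_ae (ae_of_all _ fun y => ?_)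
  show ρ y * (f (x - y) + c * g (x - y)) = ρ y * f (x - y) + c * (ρ y * g (x - y))
  ring

lemma integral_mollify (hρ : IsTestFn ρ) (hf : Continuous f) (hcf : HasCompactSupport f) :
    ∫ x, mollify ρ f x = (∫ x, ρ x) * ∫ x, f x := by
  rw [mollify_eq_convolution, integral_convolution _ hρ.integrable
    (integrable_of_continuous_hasCompactSupport hf hcf)]
  rfl

lemma mollify_nonneg (hρ0 : ∀ x, 0 ≤ ρ x) (hf : ∀ x, 0 ≤ f x) (x : Euc N) : 0 ≤ mollify ρ f x :=
  integral_nonneg fun y => mul_nonneg (hρ0 y) (hf _)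

lemma abs_mollify_sub_le (hρ : IsTestFn ρ) (hρ0 : ∀ x, 0 ≤ ρ x) (hρ1 : ∫ x, ρ x = 1)
    (hf : Continuous f) (x : Euc N) {c η : ℝ} (h : ∀ y, ρ y ≠ 0 → |f (x - y) - c| ≤ η) :
    |mollify ρ f x - c| ≤ η := by
  have e : mollify ρ f x - c = ∫ y, ρ y * (f (x - y) - c) := by
    simp only [mul_sub]
    rw [integral_sub (integrable_mollify_integrand hρ hf x) (hρ.integrable.mul_const c),
      integral_mul_const, hρ1, one_mul]
    rfl
  rw [e]
  calc |∫ y, ρ y * (f (x - y) - c)| ≤ ∫ y, ρ y * η :=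
        norm_integral_le_of_norm_le (f := fun y => ρ y * (f (x - y) - c))
          (hρ.integrable.mul_const η) (ae_of_all _ fun y => by
          rw [norm_mul, Real.norm_of_nonneg (hρ0 y), Real.norm_eq_abs]
          by_cases hy : ρ y = 0
          · simp [hy]
          · exact mul_le_mul_of_nonneg_left (h y hy) (hρ0 y))
    _ = η := by rw [integral_mul_const, hρ1, one_mul]

lemma abs_mollify_le (hρ : IsTestFn ρ) (hρ0 : ∀ x, 0 ≤ ρ x) (hρ1 : ∫ x, ρ x = 1)
    (hf : Continuous f) {B : ℝ} (hB : ∀ x, |f x| ≤ B) (x : Euc N) : |mollify ρ f x| ≤ B := by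
  simpa using abs_mollify_sub_le hρ hρ0 hρ1 hf x (c := 0) (η := B) fun y _ => by simpa using hB _

lemma secondDiff_mollify (hρ : IsTestFn ρ) (hf : Continuous f) (x z : Euc N) :
    secondDiff (mollify ρ f) x z = ∫ y, ρ y * secondDiff f (x - y) z := by
  have h1 := integrable_mollify_integrand hρ hf (x + z)
  have h2 := integrable_mollify_integrand hρ hf (x - z)
  have h3 := integrable_mollify_integrand hρ hf x
  have h12 : Integrable (fun y => ρ y * f (x + z - y) + ρ y * f (x - z - y)) := h1.add h2
  unfold secondDiff mollify
  rw [← integral_const_mul, ← integral_add h1 h2, ← integral_sub h12 (h3.const_mul 2)]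
  refine integral_congr_ae (ae_of_all _ fun y => ?_)
  beta_reduce
  show _ = ρ y * (f (x - y + z) + f (x - y - z) - 2 * f (x - y))
  rw [show x + z - y = x - y + z by abel, show x - z - y = x - y - z by abel]
  ring

lemma mollify_comm (ρ f : Euc N → ℝ) : mollify ρ f = mollify f ρ := by
  ext x
  unfold mollify
  rw [← integral_sub_left_eq_self (fun y => f y * ρ (x - y)) volume x]
  simp [mul_comm]

lemma secondDiff_mollify' (hρ : Continuous ρ) (hf : Continuous f) (hcf : HasCompactSupport f)
    (x z : Euc N) :
    secondDiff (mollify ρ f) x z = ∫ y, f y * secondDiff ρ (x - y) z := by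
  rw [mollify_comm]
  have h := fun x => integrable_mul_comp hf hcf hρ (e := fun y => x - y) (by fun_prop)
  have h12 : Integrable (fun y => f y * ρ (x + z - y) + f y * ρ (x - z - y)) :=
    (h (x + z)).add (h (x - z))
  unfold secondDiff mollify
  rw [← integral_const_mul, ← integral_add (h (x + z)) (h (x - z)),
    ← integral_sub h12 ((h x).const_mul 2)]
  refine integral_congr_ae (ae_of_all _ fun y => ?_)
  beta_reduce
  show _ = f y * (ρ (x - y + z) + ρ (x - y - z) - 2 * ρ (x - y))
  rw [show x + z - y = x - y + z by abel, show x - z - y = x - y - z by abel]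
  ring

lemma levyMass_mollify_le (hρ : Continuous ρ) (hf : Continuous f) (hcf : HasCompactSupport f) :
    levyMass ν (mollify ρ f) ≤ levyMass ν ρ * ∫⁻ x, ‖f x‖ₑ := by
  by_cases hfin : ∫⁻ x, ‖f x‖ₑ = ⊤
  · exact absurd (integrable_of_continuous_hasCompactSupport hf hcf).2.ne (by simpa using hfin)
  unfold levyMass
  rw [← lintegral_mul_const' _ _ hfin]
  refine lintegral_mono fun z => ?_
  have hm : Measurable (fun p : Euc N × Euc N => ‖f p.2‖ₑ * ‖secondDiff ρ (p.1 - p.2) z‖ₑ) := by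
    have : Continuous (fun p : Euc N × Euc N => secondDiff ρ (p.1 - p.2) z) := by
      unfold secondDiff; fun_prop
    exact (hf.comp continuous_snd).measurable.enorm.mul this.measurable.enorm
  calc ∫⁻ x, ‖secondDiff (mollify ρ f) x z‖ₑ
      ≤ ∫⁻ x, ∫⁻ y, ‖f y‖ₑ * ‖secondDiff ρ (x - y) z‖ₑ := by
        refine lintegral_mono fun x => ?_
        rw [secondDiff_mollify' hρ hf hcf]
        refine (enorm_integral_le_lintegral_enorm _).trans (lintegral_mono fun y => ?_)
        rw [enorm_mul]
    _ = ∫⁻ y, ∫⁻ x, ‖f y‖ₑ * ‖secondDiff ρ (x - y) z‖ₑ := lintegral_lintegral_swap hm.aemeasurable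
    _ = ∫⁻ y, ‖f y‖ₑ * ∫⁻ x, ‖secondDiff ρ x z‖ₑ := by
        refine lintegral_congr fun y => ?_
        rw [lintegral_const_mul' _ _ enorm_ne_top,
          lintegral_sub_right_eq_self (fun x => ‖secondDiff ρ x z‖ₑ) y]
    _ = _ := by rw [lintegral_mul_const _ hf.measurable.enorm, mul_comm]

lemma symLevy_mollify [IsFiniteMeasure ν] (hρ : IsTestFn ρ) (hf : Continuous f)
    (hcf : HasCompactSupport f) : symLevy ν (mollify ρ f) = mollify ρ (symLevy ν f) := by
  ext x
  obtain ⟨B, -, hB⟩ := exists_abs_le hf hcf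
  have hi : Integrable (fun p : Euc N × Euc N => ρ p.1 * secondDiff f (x - p.1) p.2)
      ((volume : Measure (Euc N)).prod ν) := by
    have hc : Continuous (fun p : Euc N × Euc N => secondDiff f (x - p.1) p.2) := by
      unfold secondDiff; fun_prop
    exact (hρ.integrable.comp_fst ν).mul_bdd (c := 4 * B) hc.aestronglyMeasurable
      (ae_of_all _ fun p => abs_secondDiff_le hB _ _)
  unfold symLevy
  simp only [secondDiff_mollify hρ hf]
  rw [← integral_integral_swap hi]
  unfold mollify
  rw [← integral_const_mul]
  refine integral_congr_ae (ae_of_all _ fun y => ?_)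
  simp only [integral_const_mul]
  ring

lemma symLevy_eq_add_restrict (hf : IsTestFn f) (hμ : IsLevyMeasure μ) {S : Set (Euc N)}
    (hS : MeasurableSet S) (x : Euc N) :
    symLevy μ f x = symLevy (μ.restrict S) f x + symLevy (μ.restrict Sᶜ) f x := by
  have hi := hf.integrable_secondDiff_right hμ x
  unfold symLevy
  rw [← integral_add_compl hS hi]
  ring

lemma exists_mollifier (N : ℕ) {δ : ℝ} (hδ : 0 < δ) :
    ∃ ρ : Euc N → ℝ, IsTestFn ρ ∧ (∀ x, 0 ≤ ρ x) ∧ ∫ x, ρ x = 1 ∧ ∀ x, ρ x ≠ 0 → ‖x‖ < δ := by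
  let b : ContDiffBump (0 : Euc N) := ⟨δ / 2, δ, by positivity, by linarith⟩
  refine ⟨b.normed volume, ⟨b.contDiff_normed, b.hasCompactSupport_normed⟩, b.nonneg_normed,
    b.integral_normed, fun x hx => ?_⟩
  have : x ∈ Function.support (b.normed volume) := hx
  rw [b.support_normed_eq] at this
  simpa using this

end Mollify

/-- Explicit Euler scheme for the (time-reversed) dual problem `∂_t ψ = a L[ψ]`. -/
noncomputable def dualSeq {N : ℕ} (ν : Measure (Euc N)) (h : ℝ) (a : ℕ → Euc N → ℝ)
    (θ : Euc N → ℝ) : ℕ → Euc N → ℝ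
  | 0 => θ
  | n + 1 => fun x => dualSeq ν h a θ n x + h * (a n x * symLevy ν (dualSeq ν h a θ n) x)

section DualSeq

variable {N : ℕ} {ν : Measure (Euc N)} [IsFiniteMeasure ν] {h : ℝ} {θ : Euc N → ℝ}
  {a : ℕ → Euc N → ℝ} {R : ℝ}

lemma dualSeq_continuous_hasCompactSupport (hR : ∀ᵐ z ∂ν, ‖z‖ ≤ R) (ha : ∀ n, Continuous (a n))
    (hθ : Continuous θ) (hcθ : HasCompactSupport θ) (n : ℕ) :
    Continuous (dualSeq ν h a θ n) ∧ HasCompactSupport (dualSeq ν h a θ n) := by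
  induction n with
  | zero => exact ⟨hθ, hcθ⟩
  | succ n ih =>
    exact ⟨ih.1.add (continuous_const.mul ((ha n).mul (continuous_symLevy ih.1 ih.2))),
      ih.2.add (HasCompactSupport.mul_left
        (HasCompactSupport.mul_left (hasCompactSupport_symLevy hR ih.2)))⟩

lemma dualSeq_le (hR : ∀ᵐ z ∂ν, ‖z‖ ≤ R) (ha : ∀ n, Continuous (a n))
    (hθ : Continuous θ) (hcθ : HasCompactSupport θ) (ha0 : ∀ n x, 0 ≤ a n x) (hh : 0 ≤ h)
    (hcfl : ∀ n x, h * a n x * ν.real univ ≤ 1) {B : ℝ} (hB : ∀ x, θ x ≤ B) (n : ℕ)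
    (x : Euc N) : dualSeq ν h a θ n x ≤ B := by
  induction n generalizing x with
  | zero => exact hB x
  | succ n ih =>
    obtain ⟨h1, h2⟩ := dualSeq_continuous_hasCompactSupport (h := h) hR ha hθ hcθ n
    have h3 := mul_le_mul_of_nonneg_left (symLevy_le (ν := ν) h1 h2 ih x)
      (mul_nonneg hh (ha0 n x))
    have h4 := mul_le_mul_of_nonneg_right (hcfl n x) (sub_nonneg.2 (ih x))
    simp only [dualSeq]
    nlinarith

lemma le_dualSeq (hR : ∀ᵐ z ∂ν, ‖z‖ ≤ R) (ha : ∀ n, Continuous (a n))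
    (hθ : Continuous θ) (hcθ : HasCompactSupport θ) (ha0 : ∀ n x, 0 ≤ a n x) (hh : 0 ≤ h)
    (hcfl : ∀ n x, h * a n x * ν.real univ ≤ 1) {B : ℝ} (hB : ∀ x, B ≤ θ x) (n : ℕ)
    (x : Euc N) : B ≤ dualSeq ν h a θ n x := by
  induction n generalizing x with
  | zero => exact hB x
  | succ n ih =>
    obtain ⟨h1, h2⟩ := dualSeq_continuous_hasCompactSupport (h := h) hR ha hθ hcθ n
    have h3 := mul_le_mul_of_nonneg_left (le_symLevy (ν := ν) h1 h2 ih x)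
      (mul_nonneg hh (ha0 n x))
    have h4 := mul_le_mul_of_nonneg_right (hcfl n x) (sub_nonneg.2 (ih x))
    simp only [dualSeq]
    nlinarith

lemma integral_abs_symLevy_dualSeq_le (hR : ∀ᵐ z ∂ν, ‖z‖ ≤ R) (ha : ∀ n, Continuous (a n))
    (hθ : Continuous θ) (hcθ : HasCompactSupport θ) (ha0 : ∀ n x, 0 ≤ a n x) (hh : 0 ≤ h)
    (hcfl : ∀ n x, h * a n x * ν.real univ ≤ 1) (n : ℕ) :
    ∫ x, |symLevy ν (dualSeq ν h a θ n) x| ≤ ∫ x, |symLevy ν θ x| := by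
  induction n with
  | zero => exact le_rfl
  | succ n ih =>
    obtain ⟨h1, h2⟩ := dualSeq_continuous_hasCompactSupport (h := h) hR ha hθ hcθ n
    have hg := continuous_symLevy (ν := ν) h1 h2
    have hcg := hasCompactSupport_symLevy hR h2
    refine le_trans (le_of_eq ?_) ((integral_abs_add_symLevy_le (ν := ν) hg hcg (ha n) (ha0 n) hh
      (hcfl n)).trans ih)
    refine integral_congr_ae (ae_of_all _ fun x => ?_)
    have : symLevy ν (dualSeq ν h a θ (n + 1)) x = symLevy ν (dualSeq ν h a θ n) x
        + h * symLevy ν (fun y => a n y * symLevy ν (dualSeq ν h a θ n) y) x :=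
      symLevy_add_const_mul (g := fun y => a n y * symLevy ν (dualSeq ν h a θ n) y) h1 h2
        ((ha n).mul hg) hcg.mul_left h x
    beta_reduce
    rw [this]

lemma integral_abs_dualSeq_le (hR : ∀ᵐ z ∂ν, ‖z‖ ≤ R) (ha : ∀ n, Continuous (a n))
    (hθ : Continuous θ) (hcθ : HasCompactSupport θ) (ha0 : ∀ n x, 0 ≤ a n x) (hh : 0 ≤ h)
    (hcfl : ∀ n x, h * a n x * ν.real univ ≤ 1) {A : ℝ} (hA : ∀ n x, a n x ≤ A) (n : ℕ) :
    ∫ x, |dualSeq ν h a θ n x| ≤ (∫ x, |θ x|) + n * h * A * ∫ x, |symLevy ν θ x| := by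
  have hA0 : 0 ≤ A := (ha0 0 0).trans (hA 0 0)
  induction n with
  | zero => simp [dualSeq]
  | succ n ih =>
    obtain ⟨h1, h2⟩ := dualSeq_continuous_hasCompactSupport (h := h) hR ha hθ hcθ n
    have hg := continuous_symLevy (ν := ν) h1 h2
    have hcg := hasCompactSupport_symLevy hR h2
    have hgi := (integrable_of_continuous_hasCompactSupport hg hcg).abs
    have hψi := (integrable_of_continuous_hasCompactSupport h1 h2).abs
    have hb := integral_abs_symLevy_dualSeq_le (h := h) hR ha hθ hcθ ha0 hh hcfl n
    calc ∫ x, |dualSeq ν h a θ (n + 1) x|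
        ≤ ∫ x, (|dualSeq ν h a θ n x| + h * A * |symLevy ν (dualSeq ν h a θ n) x|) := by
          refine integral_mono_of_nonneg (ae_of_all _ fun x => abs_nonneg _)
            (hψi.add (hgi.const_mul _)) (ae_of_all _ fun x => (abs_add_le _ _).trans ?_)
          rw [abs_mul, abs_mul, abs_of_nonneg hh, abs_of_nonneg (ha0 n x), ← mul_assoc]
          exact add_le_add_right (mul_le_mul_of_nonneg_right
            (mul_le_mul_of_nonneg_left (hA n x) hh) (abs_nonneg _)) _
      _ = (∫ x, |dualSeq ν h a θ n x|) + h * A * ∫ x, |symLevy ν (dualSeq ν h a θ n) x| := by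
          rw [integral_add hψi (hgi.const_mul _), integral_const_mul]
      _ ≤ _ := by
          have := mul_le_mul_of_nonneg_left hb (mul_nonneg hh hA0)
          push_cast
          linarith

/-- Discrete energy estimate. -/
lemma sum_integral_sq_symLevy_dualSeq_le (hR : ∀ᵐ z ∂ν, ‖z‖ ≤ R) (ha : ∀ n, Continuous (a n))
    (hθ : Continuous θ) (hcθ : HasCompactSupport θ) {κ : ℝ} (hκ : 0 ≤ κ)
    (haκ : ∀ n x, κ ≤ a n x) (hh : 0 ≤ h)
    (hcfl : ∀ n x, h * a n x * (2 * ν.real univ) ≤ 1) (n : ℕ) :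
    h * κ * ∑ i ∈ Finset.range n, ∫ x, symLevy ν (dualSeq ν h a θ i) x ^ 2
      ≤ (∫ x, dualSeq ν h a θ n x * symLevy ν (dualSeq ν h a θ n) x)
        - ∫ x, θ x * symLevy ν θ x := by
  induction n with
  | zero => simp [dualSeq]
  | succ n ih =>
    obtain ⟨h1, h2⟩ := dualSeq_continuous_hasCompactSupport (h := h) hR ha hθ hcθ n
    set ψ := dualSeq ν h a θ n with hψ
    have hg := continuous_symLevy (ν := ν) h1 h2
    have hcg := hasCompactSupport_symLevy hR h2
    set g := symLevy ν ψ with hgdef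
    set p : Euc N → ℝ := fun x => a n x * g x with hp
    have hpc : Continuous p := (ha n).mul hg
    have hpcc : HasCompactSupport p := hcg.mul_left
    have hLp := continuous_symLevy (ν := ν) hpc hpcc
    have i1 : Integrable (fun x => ψ x * g x) := integrable_mul_comp h1 h2 hg continuous_id
    have i2 : Integrable (fun x => ψ x * symLevy ν p x) :=
      integrable_mul_comp h1 h2 hLp continuous_id
    have i3 : Integrable (fun x => p x * g x) := integrable_mul_comp hpc hpcc hg continuous_id
    have i4 : Integrable (fun x => p x * symLevy ν p x) :=
      integrable_mul_comp hpc hpcc hLp continuous_id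
    have i5 : Integrable (fun x => p x ^ 2) := by
      simpa only [pow_two, id] using integrable_mul_comp hpc hpcc hpc continuous_id
    have i6 : Integrable (fun x => g x ^ 2) := by
      simpa only [pow_two, id] using integrable_mul_comp hg hcg hg continuous_id
    have e1 : ∫ x, dualSeq ν h a θ (n + 1) x * symLevy ν (dualSeq ν h a θ (n + 1)) x
        = (∫ x, ψ x * g x) + h * (∫ x, ψ x * symLevy ν p x) + h * (∫ x, p x * g x)
          + h ^ 2 * ∫ x, p x * symLevy ν p x := by
      have j12 : Integrable (fun x => ψ x * g x + h * (ψ x * symLevy ν p x)) :=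
        i1.add (i2.const_mul h)
      have j123 : Integrable (fun x => ψ x * g x + h * (ψ x * symLevy ν p x) + h * (p x * g x)) :=
        j12.add (i3.const_mul h)
      rw [← integral_const_mul, ← integral_const_mul, ← integral_const_mul,
        ← integral_add i1 (i2.const_mul h), ← integral_add j12 (i3.const_mul h),
        ← integral_add j123 (i4.const_mul _)]
      refine integral_congr_ae (ae_of_all _ fun x => ?_)
      have : symLevy ν (dualSeq ν h a θ (n + 1)) x = g x + h * symLevy ν p x :=
        symLevy_add_const_mul h1 h2 hpc hpcc h x
      beta_reduce
      rw [this]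
      show (ψ x + h * p x) * _ = _
      ring
    have e2 : ∫ x, ψ x * symLevy ν p x = ∫ x, p x * g x :=
      integral_mul_symLevy_comm hpc hpcc h1 h2
    have e3 := le_integral_mul_symLevy_self (ν := ν) hpc hpcc
    have e4 : h * κ * (∫ x, g x ^ 2) + h ^ 2 * (2 * ν.real univ) * ∫ x, p x ^ 2
        ≤ 2 * h * ∫ x, p x * g x := by
      rw [← integral_const_mul, ← integral_const_mul, ← integral_const_mul,
        ← integral_add (i6.const_mul _) (i5.const_mul _)]
      refine integral_mono ((i6.const_mul _).add (i5.const_mul _)) (i3.const_mul _) fun x => ?_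
      have hax := haκ n x
      have q0 : 0 ≤ h * a n x * g x ^ 2 := by
        have := hκ.trans hax
        positivity
      have q1 := mul_le_mul_of_nonneg_right (hcfl n x) q0
      have q2 : h * κ * g x ^ 2 ≤ h * a n x * g x ^ 2 := by gcongr
      simp only [hp]
      nlinarith
    rw [Finset.sum_range_succ, mul_add, e1, e2]
    have e5 := mul_le_mul_of_nonneg_left e3 (sq_nonneg h)
    nlinarith

end DualSeq

/-- If `U' = W` weakly on `[0,T)` with initial value `U0`, then `U` is the primitive of `W`. -/
lemma eq_add_integral_of_weak_deriv {T : ℝ} (hT : 0 < T) {U W : ℝ → ℝ} {U0 : ℝ}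
    (hU : ContinuousOn U (Icc 0 T)) (hW : IntegrableOn W (Ioo 0 T))
    (h : ∀ χ : ℝ → ℝ, ContDiff ℝ (⊤ : ℕ∞) χ → HasCompactSupport χ → tsupport χ ⊆ Iio T →
      (∫ s in Ioo (0 : ℝ) T, (deriv χ s * U s + χ s * W s)) + χ 0 * U0 = 0)
    {t : ℝ} (ht : t ∈ Icc 0 T) : U t = U0 + ∫ s in (0 : ℝ)..t, W s := by
  have hWi : IntervalIntegrable W volume 0 T := by
    rwa [intervalIntegrable_iff_integrableOn_Ioo_of_le hT.le]
  have h0T : uIcc 0 T = Icc 0 T := uIcc_of_le hT.le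
  set I : ℝ → ℝ := fun τ => ∫ s in (0 : ℝ)..τ, W s with hI
  have hIac : AbsolutelyContinuousOnInterval I 0 T :=
    hWi.absolutelyContinuousOnInterval_intervalIntegral left_mem_uIcc
  have hIc : ContinuousOn I (Icc 0 T) := h0T ▸ hIac.continuousOn
  have hdI : ∀ᵐ τ ∂volume.restrict (Ioo 0 T), deriv I τ = W τ := by
    rw [ae_restrict_iff' measurableSet_Ioo]
    filter_upwards [hWi.ae_hasDerivAt_integral] with τ hτ hm
    exact (hτ (h0T ▸ Ioo_subset_Icc_self hm) 0 left_mem_uIcc).deriv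
  have hGc : ContinuousOn (fun τ => U τ - U0 - I τ) (Icc 0 T) := (hU.sub continuousOn_const).sub hIc
  have key : ∀ᵐ τ ∂(volume : Measure ℝ), τ ∈ Ioo 0 T → U τ - U0 - I τ = 0 := by
    refine isOpen_Ioo.ae_eq_zero_of_integral_contDiff_smul_eq_zero
      ((hGc.mono Ioo_subset_Icc_self).locallyIntegrableOn measurableSet_Ioo) fun g hg hgc hgs => ?_
    set G : ℝ → ℝ := fun τ => (∫ s in (0 : ℝ)..τ, g s) - ∫ s in (0 : ℝ)..T, g s with hG
    have hGd : ∀ τ, HasDerivAt G (g τ) τ := fun τ =>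
      (hg.continuous.integral_hasStrictDerivAt 0 τ).hasDerivAt.sub_const _
    have hdG : deriv G = g := funext fun τ => (hGd τ).deriv
    have hGs : ContDiff ℝ (⊤ : ℕ∞) G := by
      rw [contDiff_infty_iff_deriv, hdG]
      exact ⟨fun τ => (hGd τ).differentiableAt, hg⟩
    let b : ContDiffBump (0 : ℝ) := ⟨T + 1, T + 2, by linarith, by linarith⟩
    have hb : ∀ τ ∈ Icc 0 T, b τ = 1 := fun τ hτ => b.one_of_mem_closedBall (by
      simp only [Metric.mem_closedBall, dist_zero_right, Real.norm_eq_abs, abs_of_nonneg hτ.1, b]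
      linarith [hτ.2])
    have hχd : ∀ τ ∈ Ioo 0 T, deriv (fun τ => G τ * b τ) τ = g τ := fun τ hτ => by
      rw [← hdG]
      refine EventuallyEq.deriv_eq ?_
      filter_upwards [Ioo_mem_nhds hτ.1 hτ.2] with σ hσ
      rw [hb σ (Ioo_subset_Icc_self hσ), mul_one]
    have hGT : G T = 0 := sub_self _
    have htest := h (fun τ => G τ * b τ) (hGs.mul b.contDiff) (b.hasCompactSupport.mul_left) (by
      have hGsupp : tsupport G ⊆ Iio T := by
        obtain ⟨c, hc, hcs⟩ : ∃ c < T, tsupport g ⊆ Iic c := by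
          rcases (tsupport g).eq_empty_or_nonempty with he | hne
          · exact ⟨T - 1, by linarith, by simp [he]⟩
          · obtain ⟨c, hc, hm⟩ := hgc.isCompact.exists_isGreatest hne
            exact ⟨c, (hgs hc).2, fun x hx => hm hx⟩
        refine (closure_minimal (fun τ hτ => ?_) isClosed_Iic).trans (Iic_subset_Iio.2 hc)
        by_contra hlt
        refine hτ ?_
        have hz : ∀ s, c < s → g s = 0 := fun s hs => image_eq_zero_of_notMem_tsupport
          fun hm => absurd (hcs hm) (not_le.2 hs)
        rw [hG]
        beta_reduce
        rw [intervalIntegral.integral_interval_sub_left (hg.continuous.intervalIntegrable _ _)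
          (hg.continuous.intervalIntegrable _ _)]
        refine intervalIntegral.integral_zero_ae (ae_of_all _ fun s hs => hz s ?_)
        exact lt_of_le_of_lt (le_min hc.le (not_le.1 hlt).le) hs.1
      exact (tsupport_mul_subset_left).trans hGsupp)
    have hibp := (hGs.contDiffOn.of_le (by simp)).absolutelyContinuousOnInterval
      |>.integral_mul_deriv_eq_deriv_mul hIac (f := G)
    have hI0 : I 0 = 0 := intervalIntegral.integral_same
    rw [hGT, hI0, hdG, mul_zero, zero_mul, sub_zero, zero_sub,
      intervalIntegral.integral_of_le hT.le, intervalIntegral.integral_of_le hT.le,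
      integral_Ioc_eq_integral_Ioo, integral_Ioc_eq_integral_Ioo] at hibp
    have e1 : ∫ s in Ioo 0 T, G s * deriv I s = ∫ s in Ioo 0 T, G s * W s :=
      integral_congr_ae (by filter_upwards [hdI] with s hs; rw [hs])
    have hG0 : G 0 = - ∫ s in Ioo 0 T, g s := by
      simp [hG, intervalIntegral.integral_of_le hT.le, integral_Ioc_eq_integral_Ioo]
    have ig : ∀ {f : ℝ → ℝ}, ContinuousOn f (Icc 0 T) → IntegrableOn f (Ioo 0 T) := fun hf =>
      (hf.integrableOn_Icc).mono_set Ioo_subset_Icc_self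
    have i1 : IntegrableOn (fun s => g s * U s) (Ioo 0 T) := ig (hg.continuous.continuousOn.mul hU)
    have i2 : IntegrableOn (fun s => G s * W s) (Ioo 0 T) := by
      refine (IntegrableOn.continuousOn_mul (K := Icc 0 T) hGs.continuous.continuousOn ?_
        isCompact_Icc).mono_set Ioo_subset_Icc_self
      exact hW.congr_set_ae Ioo_ae_eq_Icc.symm
    have i3 : IntegrableOn (fun s => g s * I s) (Ioo 0 T) := ig (hg.continuous.continuousOn.mul hIc)
    have i4 : IntegrableOn (fun s => g s * U0) (Ioo 0 T) :=
      ig (hg.continuous.continuousOn.mul continuousOn_const)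
    have e2 : ∫ s in Ioo 0 T, (deriv (fun τ => G τ * b τ) s * U s + G s * b s * W s)
        = (∫ s in Ioo 0 T, g s * U s) + ∫ s in Ioo 0 T, G s * W s := by
      rw [← integral_add i1 i2]
      refine setIntegral_congr_fun measurableSet_Ioo fun s hs => ?_
      rw [hχd s hs, hb s (Ioo_subset_Icc_self hs), mul_one]
    rw [e2, hb 0 ⟨le_rfl, hT.le⟩, hG0, mul_one, neg_mul, ← integral_mul_const] at htest
    have e3 : ∫ s, g s • (U s - U0 - I s) = ∫ s in Ioo 0 T, g s * (U s - U0 - I s) := by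
      refine (setIntegral_eq_integral_of_forall_compl_eq_zero fun s hs => ?_).symm
      rw [image_eq_zero_of_notMem_tsupport fun hm => hs (hgs hm), zero_smul]
    have e4 : ∫ s in Ioo 0 T, g s * (U s - U0 - I s) = (∫ s in Ioo 0 T, g s * U s)
        - (∫ s in Ioo 0 T, g s * U0) - ∫ s in Ioo 0 T, g s * I s := by
      simp only [mul_sub]
      have i14 : IntegrableOn (fun s => g s * U s - g s * U0) (Ioo 0 T) := i1.sub i4
      rw [integral_sub i14 i3, integral_sub i1 i4]
    rw [e3, e4]
    linarith
  have := Measure.eqOn_Icc_of_ae_eq (μ := volume) hT.ne (f := fun τ => U τ - U0 - I τ)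
    (g := fun _ => 0) (by
      rw [Measure.restrict_congr_set (Ioo_ae_eq_Icc (a := (0 : ℝ)) (b := T)).symm]
      exact (ae_restrict_iff' measurableSet_Ioo).2 key) hGc continuousOn_const ht
  simp only [hI] at this
  linarith

/-- The space-time measure on the slab `ℝ^N × (s,t)`. -/
noncomputable def slab (N : ℕ) (s t : ℝ) : Measure (Euc N × ℝ) :=
  (volume : Measure (Euc N)).prod ((volume : Measure ℝ).restrict (Ioo s t))

lemma slab_eq_restrict {N : ℕ} {s t T : ℝ} (hs : 0 ≤ s) (ht : t ≤ T) :
    slab N s t = (QTvol N T).restrict (univ ×ˢ Ioo s t) := by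
  unfold slab QTvol
  rw [← Measure.prod_restrict, Measure.restrict_univ,
    Measure.restrict_restrict_of_subset (Ioo_subset_Ioo hs ht)]

instance {N : ℕ} {s t : ℝ} : SFinite (slab N s t) := by unfold slab; infer_instance

lemma slab_le {N : ℕ} {s t T : ℝ} (hs : 0 ≤ s) (ht : t ≤ T) : slab N s t ≤ QTvol N T := by
  rw [slab_eq_restrict hs ht]
  exact Measure.restrict_le_self

section Solution

variable {N : ℕ} {T : ℝ} {φ : ℝ → ℝ} {μ : Measure (Euc N)} {u0 : Euc N → ℝ}
  {u : Euc N → ℝ → ℝ} {ζ : Euc N → ℝ}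

lemma MemCL1loc.integrable_mul (huC : MemCL1loc T u) (hζ : Continuous ζ) (hcζ : HasCompactSupport ζ)
    {t : ℝ} (ht : t ∈ Icc 0 T) : Integrable (fun x => u x t * ζ x) := by
  have h := (huC _ hcζ.isCompact).1 t ht
  have h2 := h.mul_continuousOn hζ.continuousOn hcζ.isCompact
  refine h2.integrable_of_forall_notMem_eq_zero fun x hx => ?_
  rw [image_eq_zero_of_notMem_tsupport hx, mul_zero]

lemma MemCL1loc.continuousOn_integral (huC : MemCL1loc T u) (hζ : Continuous ζ)
    (hcζ : HasCompactSupport ζ) : ContinuousOn (fun t => ∫ x, u x t * ζ x) (Icc 0 T) := by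
  intro t ht
  obtain ⟨B, hB0, hB⟩ := exists_abs_le hζ hcζ
  have h := ((huC _ hcζ.isCompact).2 t ht).mul_const B
  rw [zero_mul] at h
  rw [ContinuousWithinAt, tendsto_iff_dist_tendsto_zero]
  refine squeeze_zero' (Eventually.of_forall fun s => dist_nonneg) ?_ h
  filter_upwards [self_mem_nhdsWithin] with s hs
  rw [Real.dist_eq, ← integral_sub (huC.integrable_mul hζ hcζ hs) (huC.integrable_mul hζ hcζ ht),
    ← integral_mul_const]
  have hi : IntegrableOn (fun x => |u x s - u x t| * B) (tsupport ζ) :=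
    (((huC _ hcζ.isCompact).1 s hs).sub ((huC _ hcζ.isCompact).1 t ht)).abs.mul_const B
  have e : ∫ x, (u x s * ζ x - u x t * ζ x) = ∫ x in tsupport ζ, (u x s * ζ x - u x t * ζ x) :=
    (setIntegral_eq_integral_of_forall_compl_eq_zero fun x hx => by
      simp [image_eq_zero_of_notMem_tsupport hx]).symm
  rw [e, ← Real.norm_eq_abs]
  refine norm_integral_le_of_norm_le hi (ae_of_all _ fun x => ?_)
  rw [← sub_mul, norm_mul]
  exact mul_le_mul_of_nonneg_left (hB x) (norm_nonneg _)

lemma MemLinfQT.exists_abs_comp_le (hu : MemLinfQT T u) (hφ : Continuous φ) :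
    ∃ W, 0 ≤ W ∧ ∀ᵐ p ∂QTvol N T, |φ (u p.1 p.2)| ≤ W := by
  obtain ⟨M, hM⟩ := hu.2
  obtain ⟨W, hW⟩ := (isCompact_Icc (a := -M) (b := M)).exists_bound_of_continuousOn
    hφ.continuousOn
  refine ⟨max W 0, le_max_right _ _, ?_⟩
  filter_upwards [hM] with p hp
  exact (hW _ (abs_le.1 hp)).trans (le_max_left _ _)

lemma integrable_comp_mul (hu : MemLinfQT T u) (hφ : Continuous φ) {g : Euc N → ℝ}
    (hg : Integrable g) : Integrable (fun p : Euc N × ℝ => φ (u p.1 p.2) * g p.1) (QTvol N T) := by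
  obtain ⟨W, -, hW⟩ := hu.exists_abs_comp_le hφ
  have : Integrable (fun p : Euc N × ℝ => g p.1) (QTvol N T) :=
    hg.comp_fst (volume.restrict (Ioo (0 : ℝ) T))
  exact this.bdd_mul (c := W) (hφ.comp_aestronglyMeasurable hu.1) hW

lemma integral_slab {f : Euc N × ℝ → ℝ} {s t : ℝ} (hst : s ≤ t) (hf : Integrable f (slab N s t)) :
    ∫ p, f p ∂slab N s t = ∫ τ in s..t, ∫ x, f (x, τ) := by
  unfold slab at *
  rw [integral_prod_symm _ hf, intervalIntegral.integral_of_le hst, integral_Ioc_eq_integral_Ioo]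

lemma Lop_mul_const (c : ℝ) (x : Euc N) (hζ : IsTestFn ζ) :
    Lop μ (fun y => ζ y * c) x = c * Lop μ ζ x := by
  unfold Lop
  rw [← integral_const_mul]
  refine integral_congr_ae (ae_of_all _ fun z => ?_)
  have hd : DifferentiableAt ℝ ζ x := hζ.1.differentiable (by simp) x
  beta_reduce
  rw [fderiv_mul_const hd]
  split_ifs <;> simp <;> ring

/-- The weak formulation tested at a fixed time. -/
lemma integral_mul_eq_add_integral (hT : 0 < T) (hφ : Continuous φ) (hμ : IsLevyMeasure μ)
    (hu : MemLinfQT T u) (huC : MemCL1loc T u) (husol : IsDistSolOp T (Lop μ) φ u0 u)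
    (hζ : IsTestFn ζ) {t : ℝ} (ht : t ∈ Icc 0 T) :
    ∫ x, u x t * ζ x = (∫ x, u0 x * ζ x)
      + ∫ s in (0 : ℝ)..t, ∫ x, φ (u x s) * symLevy μ ζ x := by
  have := hμ.sFinite
  have hL : Lop μ ζ = symLevy μ ζ := Lop_eq_symLevy hζ hμ
  have hgi : Integrable (symLevy μ ζ) := integrable_symLevy hζ.continuous (hζ.levyMass_ne_top hμ)
  have hUφ := integrable_comp_mul hu hφ hgi
  refine eq_add_integral_of_weak_deriv hT (U := fun t => ∫ x, u x t * ζ x)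
    (huC.continuousOn_integral hζ.continuous hζ.2) hUφ.integral_prod_right
    (fun χ hχ hcχ hsχ => ?_) ht
  have hK : tsupport (Function.uncurry fun x s => ζ x * χ s) ⊆ tsupport ζ ×ˢ tsupport χ := by
    refine closure_minimal (fun p hp => ?_)
      ((isClosed_tsupport _).prod (isClosed_tsupport _))
    have hp' : ζ p.1 * χ p.2 ≠ 0 := hp
    exact ⟨subset_tsupport _ (left_ne_zero_of_mul hp'), subset_tsupport _ (right_ne_zero_of_mul hp')⟩
  have h := husol (fun x s => ζ x * χ s) ⟨?_, ?_, ?_⟩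
  · refine Eq.trans ?_ h
    congr 1
    · refine integral_congr_ae ?_
      filter_upwards [hUφ.prod_left_ae, ae_restrict_mem measurableSet_Ioo] with s hs hs0
      have h1 := huC.integrable_mul hζ.continuous hζ.2 (Ioo_subset_Icc_self hs0)
      rw [← integral_const_mul, ← integral_const_mul,
        ← integral_add (h1.const_mul _) (hs.const_mul _)]
      refine integral_congr_ae (ae_of_all _ fun x => ?_)
      beta_reduce
      rw [Lop_mul_const _ _ hζ, hL, deriv_const_mul_field]
      ring
    · rw [← integral_const_mul]
      refine integral_congr_ae (ae_of_all _ fun x => ?_)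
      beta_reduce
      ring
  · exact (hζ.1.comp contDiff_fst).mul (hχ.comp contDiff_snd)
  · exact (hζ.2.isCompact.prod hcχ.isCompact).of_isClosed_subset (isClosed_tsupport _) hK
  · exact fun p hp => hsχ (hK hp).2

lemma integral_sub_mul_eq_add_slab (hT : 0 < T) (hφ : Continuous φ) (hμ : IsLevyMeasure μ)
    (hu : MemLinfQT T u) (huC : MemCL1loc T u) (husol : IsDistSolOp T (Lop μ) φ u0 u)
    (hζ : IsTestFn ζ) (C : ℝ) {s t : ℝ} (hs : 0 ≤ s) (hst : s ≤ t) (ht : t ≤ T) :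
    ∫ x, (u x t - C) * ζ x = (∫ x, (u x s - C) * ζ x)
      + ∫ p, (φ (u p.1 p.2) - φ C) * symLevy μ ζ p.1 ∂slab N s t := by
  have := hμ.sFinite
  have hgi : Integrable (symLevy μ ζ) := integrable_symLevy hζ.continuous (hζ.levyMass_ne_top hμ)
  have hUφ := integrable_comp_mul hu hφ hgi
  have hUφ' := integrable_comp_mul hu (φ := fun r => φ r - φ C) (hφ.sub continuous_const) hgi
  have hV : ∀ τ ∈ Icc 0 T, ∫ x, (u x τ - C) * ζ x = (∫ x, u x τ * ζ x) - C * ∫ x, ζ x := by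
    intro τ hτ
    simp only [sub_mul]
    rw [integral_sub (huC.integrable_mul hζ.continuous hζ.2 hτ) (hζ.integrable.const_mul C),
      integral_const_mul]
  have hs' : s ∈ Icc 0 T := ⟨hs, hst.trans ht⟩
  have ht' : t ∈ Icc 0 T := ⟨hs.trans hst, ht⟩
  have hWi : ∀ τ ∈ Icc 0 T, IntervalIntegrable
      (fun τ => ∫ x, φ (u x τ) * symLevy μ ζ x) volume 0 τ := fun τ hτ => by
    rw [intervalIntegrable_iff_integrableOn_Ioo_of_le hτ.1]
    exact IntegrableOn.mono_set hUφ.integral_prod_right (Ioo_subset_Ioo_right hτ.2)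
  rw [hV t ht', hV s hs', integral_mul_eq_add_integral hT hφ hμ hu huC husol hζ ht',
    integral_mul_eq_add_integral hT hφ hμ hu huC husol hζ hs',
    integral_slab hst (hUφ'.mono_measure (slab_le hs ht))]
  have hsub := intervalIntegral.integral_interval_sub_left (hWi t ht') (hWi s hs')
  have e : ∫ τ in s..t, ∫ x, (φ (u x τ) - φ C) * symLevy μ ζ x
      = ∫ τ in s..t, ∫ x, φ (u x τ) * symLevy μ ζ x := by
    rw [intervalIntegral.integral_of_le hst, intervalIntegral.integral_of_le hst,
      integral_Ioc_eq_integral_Ioo, integral_Ioc_eq_integral_Ioo]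
    refine integral_congr_ae ?_
    filter_upwards [ae_restrict_of_ae_restrict_of_subset (Ioo_subset_Ioo hs ht)
      hUφ.prod_left_ae] with τ hτ
    simp only [sub_mul]
    rw [integral_sub hτ (hgi.const_mul _), integral_const_mul,
      integral_symLevy hζ.continuous hζ.integrable (hζ.levyMass_ne_top hμ), mul_zero, sub_zero]
  linarith

lemma integral_sub_mul_zero (hT : 0 < T) (hφ : Continuous φ) (hμ : IsLevyMeasure μ)
    (hu0 : Integrable u0)
    (hu : MemLinfQT T u) (huC : MemCL1loc T u) (husol : IsDistSolOp T (Lop μ) φ u0 u)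
    (hζ : IsTestFn ζ) (C : ℝ) : ∫ x, (u x 0 - C) * ζ x = ∫ x, (u0 x - C) * ζ x := by
  have h0 : (0 : ℝ) ∈ Icc 0 T := ⟨le_rfl, hT.le⟩
  have h := integral_mul_eq_add_integral hT hφ hμ hu huC husol hζ h0
  rw [intervalIntegral.integral_same, add_zero] at h
  obtain ⟨B, -, hB⟩ := exists_abs_le hζ.continuous hζ.2
  simp only [sub_mul]
  rw [integral_sub (huC.integrable_mul hζ.continuous hζ.2 h0) (hζ.integrable.const_mul C),
    integral_sub (hu0.mul_bdd (c := B) hζ.continuous.aestronglyMeasurable (ae_of_all _ hB))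
      (hζ.integrable.const_mul C), h]

end Solution

section Step

variable {N : ℕ} {T : ℝ} {φ : ℝ → ℝ} {μ ν : Measure (Euc N)} {u0 : Euc N → ℝ}
  {u : Euc N → ℝ → ℝ} {ρ ψ a g f : Euc N → ℝ}

lemma integral_slab_fst {s t : ℝ} (hst : s ≤ t) (f : Euc N → ℝ) :
    ∫ p, f p.1 ∂slab N s t = (t - s) * ∫ x, f x := by
  unfold slab
  rw [integral_fun_fst]
  simp [Measure.real, hst]

lemma integrable_slab_fst {s t : ℝ} (hf : Integrable f) :
    Integrable (fun p : Euc N × ℝ => f p.1) (slab N s t) := hf.comp_fst _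

lemma abs_integral_slab_mul_le {s t : ℝ} (hst : s ≤ t) {w : Euc N × ℝ → ℝ} {W : ℝ}
    (hw : ∀ᵐ p ∂slab N s t, |w p| ≤ W) (hg : Integrable g) :
    |∫ p, w p * g p.1 ∂slab N s t| ≤ (t - s) * W * ∫ x, |g x| := by
  rw [mul_assoc, ← integral_const_mul, ← integral_slab_fst hst, ← Real.norm_eq_abs]
  refine norm_integral_le_of_norm_le (integrable_slab_fst (hg.abs.const_mul W)) ?_
  filter_upwards [hw] with p hp
  rw [norm_mul]
  exact mul_le_mul_of_nonneg_right hp (norm_nonneg _)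

lemma integral_abs_symLevy_le [SFinite ν] (hf : Continuous f) (h : levyMass ν f ≠ ⊤) :
    ∫ x, |symLevy ν f x| ≤ (levyMass ν f).toReal := by
  have := integral_norm_eq_lintegral_enorm (integrable_symLevy hf h).aestronglyMeasurable
  simp only [Real.norm_eq_abs] at this
  rw [this]
  exact ENNReal.toReal_mono h (lintegral_enorm_symLevy_le hf)

lemma levyMass_mollify_ne_top (hρ : Continuous ρ) (hf : Continuous f) (hcf : HasCompactSupport f)
    (h : levyMass ν ρ ≠ ⊤) : levyMass ν (mollify ρ f) ≠ ⊤ :=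
  ne_top_of_le_ne_top (ENNReal.mul_ne_top h
    (integrable_of_continuous_hasCompactSupport hf hcf).2.ne) (levyMass_mollify_le hρ hf hcf)

lemma integral_abs_symLevy_mollify_le [SFinite ν] (hρ : IsTestFn ρ) (hf : Continuous f)
    (hcf : HasCompactSupport f) (h : levyMass ν ρ ≠ ⊤) :
    ∫ x, |symLevy ν (mollify ρ f) x| ≤ (levyMass ν ρ).toReal * ∫ x, |f x| := by
  have hi := integrable_of_continuous_hasCompactSupport hf hcf
  refine (integral_abs_symLevy_le (isTestFn_mollify hρ hf hcf).continuous
    (levyMass_mollify_ne_top hρ.continuous hf hcf h)).trans ?_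
  have := integral_norm_eq_lintegral_enorm hi.aestronglyMeasurable
  simp only [Real.norm_eq_abs] at this
  rw [this, ← ENNReal.toReal_mul]
  exact ENNReal.toReal_mono (ENNReal.mul_ne_top h hi.2.ne)
    (levyMass_mollify_le hρ.continuous hf hcf)

lemma abs_mul_mollify_sub_le (hρ : IsTestFn ρ) (hρ0 : ∀ x, 0 ≤ ρ x) (hρ1 : ∫ x, ρ x = 1)
    (ha : Continuous a) (hg : Continuous g) {w v η D d l : ℝ} (hl : 0 < l) {x : Euc N}
    (h : ∀ y, ρ y ≠ 0 → |w - a (x - y) * v| ≤ η + D * |d|) :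
    |w * mollify ρ g x - v * mollify ρ (fun y => a y * g y) x|
      ≤ η * mollify ρ (fun y => |g y|) x + l * mollify ρ (fun y => g y ^ 2) x
        + D ^ 2 / (4 * l) * d ^ 2 := by
  have hgabs : Continuous (fun y => |g y|) := hg.abs
  have hgsq : Continuous (fun y => g y ^ 2) := hg.pow 2
  have i1 := integrable_mollify_integrand hρ hg x
  have i2 := integrable_mollify_integrand hρ (f := fun y => a y * g y) (ha.mul hg) x
  have i3 := (integrable_mollify_integrand hρ hgabs x).const_mul η
  have i4 := (integrable_mollify_integrand hρ hgsq x).const_mul l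
  have i5 := hρ.integrable.mul_const (D ^ 2 / (4 * l) * d ^ 2)
  have i34 : Integrable (fun y => η * (ρ y * |g (x - y)|) + l * (ρ y * g (x - y) ^ 2)) := i3.add i4
  have e1 : w * mollify ρ g x - v * mollify ρ (fun y => a y * g y) x
      = ∫ y, (w * (ρ y * g (x - y)) - v * (ρ y * (a (x - y) * g (x - y)))) := by
    rw [integral_sub (i1.const_mul w) (i2.const_mul v), integral_const_mul, integral_const_mul]
    rfl
  have e2 : η * mollify ρ (fun y => |g y|) x + l * mollify ρ (fun y => g y ^ 2) x
        + D ^ 2 / (4 * l) * d ^ 2 = ∫ y, (η * (ρ y * |g (x - y)|) + l * (ρ y * g (x - y) ^ 2)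
        + ρ y * (D ^ 2 / (4 * l) * d ^ 2)) := by
    rw [integral_add i34 i5, integral_add i3 i4, integral_const_mul, integral_const_mul,
      integral_mul_const, hρ1, one_mul]
    rfl
  rw [e1, e2, ← Real.norm_eq_abs]
  refine norm_integral_le_of_norm_le (i34.add i5) (ae_of_all _ fun y => ?_)
  by_cases hy : ρ y = 0
  · simp [hy]
  have hb := h y hy
  set G := g (x - y)
  have e3 : w * (ρ y * G) - v * (ρ y * (a (x - y) * G)) = ρ y * ((w - a (x - y) * v) * G) := by ring
  rw [e3, norm_mul, norm_mul, Real.norm_eq_abs, Real.norm_eq_abs, Real.norm_eq_abs,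
    abs_of_nonneg (hρ0 y)]
  have e4 : D * |d| * |G| ≤ l * G ^ 2 + D ^ 2 / (4 * l) * d ^ 2 := by
    have h1 : l * G ^ 2 + D ^ 2 / (4 * l) * d ^ 2 - D * |d| * |G|
        = (2 * l * |G| - D * |d|) ^ 2 / (4 * l) := by
      rw [← sq_abs G, ← sq_abs d]
      field_simp
      ring
    have : 0 ≤ (2 * l * |G| - D * |d|) ^ 2 / (4 * l) := by positivity
    linarith
  have e5 := mul_le_mul_of_nonneg_right hb (abs_nonneg G)
  have e6 : |w - a (x - y) * v| * |G| ≤ η * |G| + (l * G ^ 2 + D ^ 2 / (4 * l) * d ^ 2) := by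
    linarith
  have := mul_le_mul_of_nonneg_left e6 (hρ0 y)
  refine this.trans (le_of_eq ?_)
  ring

/-- Freezing the dual variable on a short time interval costs an error quadratic in its length. -/
lemma abs_integral_slab_sub_le (hT : 0 < T) (hφ : Continuous φ) (hμ : IsLevyMeasure μ)
    (hu : MemLinfQT T u) (huC : MemCL1loc T u) (husol : IsDistSolOp T (Lop μ) φ u0 u)
    (hρ : IsTestFn ρ) (hf : Continuous f) (hcf : HasCompactSupport f)
    (C : ℝ) {W : ℝ} (hW0 : 0 ≤ W) (hW : ∀ᵐ p ∂QTvol N T, |φ (u p.1 p.2) - φ C| ≤ W)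
    {s t : ℝ} (hs : 0 ≤ s) (hst : s ≤ t) (ht : t ≤ T) :
    |(∫ p, (u p.1 p.2 - C) * mollify ρ f p.1 ∂slab N s t)
        - (t - s) * ∫ x, (u x s - C) * mollify ρ f x|
      ≤ (t - s) ^ 2 * W * (levyMass μ ρ).toReal * ∫ x, |f x| := by
  have := hμ.sFinite
  have hm := isTestFn_mollify hρ hf hcf
  have hLρ := hρ.levyMass_ne_top hμ
  have hUφ := (integrable_comp_mul hu (φ := fun r => r - C) (by fun_prop)
    hm.integrable).mono_measure (slab_le hs ht)
  have hVi : IntervalIntegrable (fun τ => ∫ x, (u x τ - C) * mollify ρ f x) volume s t := by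
    rw [intervalIntegrable_iff_integrableOn_Ioo_of_le hst]
    exact Integrable.integral_prod_right hUφ
  rw [integral_slab hst hUφ, ← smul_eq_mul (t - s), ← intervalIntegral.integral_const,
    ← intervalIntegral.integral_sub hVi intervalIntegrable_const, ← Real.norm_eq_abs]
  have hb : ∀ τ ∈ uIoc s t, ‖(∫ x, (u x τ - C) * mollify ρ f x)
      - ∫ x, (u x s - C) * mollify ρ f x‖
      ≤ (t - s) * W * ((levyMass μ ρ).toReal * ∫ x, |f x|) := by
    intro τ hτ
    rw [uIoc_of_le hst] at hτ
    have hτT := hτ.2.trans ht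
    have hWτ := ae_mono (slab_le (N := N) (t := τ) hs hτT) hW
    rw [integral_sub_mul_eq_add_slab hT hφ hμ hu huC husol hm C hs hτ.1.le hτT,
      add_sub_cancel_left, Real.norm_eq_abs]
    have hLm : levyMass μ (mollify ρ f) ≠ ⊤ := levyMass_mollify_ne_top hρ.continuous hf hcf hLρ
    refine (abs_integral_slab_mul_le hτ.1.le hWτ
      (integrable_symLevy hm.continuous hLm)).trans ?_
    have := hτ.2
    have h0 : 0 ≤ t - s := by linarith
    gcongr
    exact integral_abs_symLevy_mollify_le hρ hf hcf hLρ
  refine (intervalIntegral.norm_integral_le_of_norm_le_const hb).trans (le_of_eq ?_)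
  rw [abs_of_nonneg (by linarith)]
  ring

/-- One step of the dual scheme. -/
lemma abs_step_le (hT : 0 < T) (hφ : Continuous φ) (hμ : IsLevyMeasure μ)
    (hu : MemLinfQT T u) (huC : MemCL1loc T u) (husol : IsDistSolOp T (Lop μ) φ u0 u)
    (hρ : IsTestFn ρ) (hρ0 : ∀ x, 0 ≤ ρ x) (hρ1 : ∫ x, ρ x = 1)
    (hψ : Continuous ψ) (hcψ : HasCompactSupport ψ) (ha : Continuous a) (ha0 : ∀ x, 0 ≤ a x)
    {A : ℝ} (hA : ∀ x, a x ≤ A) {S : Set (Euc N)} (hS : MeasurableSet S) (hμS : μ S ≠ ⊤)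
    {R : ℝ} (hR : ∀ z ∈ S, ‖z‖ ≤ R)
    (C : ℝ) {W : ℝ} (hW0 : 0 ≤ W) (hW : ∀ᵐ p ∂QTvol N T, |φ (u p.1 p.2) - φ C| ≤ W)
    {s t : ℝ} (hs : 0 ≤ s) (hst : s ≤ t) (ht : t ≤ T) {η D l : ℝ} (hl : 0 < l)
    {d : Euc N × ℝ → ℝ} (hd : Integrable (fun p => d p ^ 2) (QTvol N T))
    (hest : ∀ᵐ p ∂slab N s t, ∀ y, ρ y ≠ 0 →
      |φ (u p.1 p.2) - φ C - a (p.1 - y) * (u p.1 p.2 - C)| ≤ η + D * |d p|) :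
    |(∫ x, (u x t - C) * mollify ρ ψ x) - ∫ x, (u x s - C)
        * mollify ρ (fun y => ψ y + (t - s) * (a y * symLevy (μ.restrict S) ψ y)) x|
      ≤ (t - s) * η * (∫ x, |symLevy (μ.restrict S) ψ x|)
        + (t - s) * l * (∫ x, symLevy (μ.restrict S) ψ x ^ 2)
        + D ^ 2 / (4 * l) * (∫ p, d p ^ 2 ∂slab N s t)
        + (t - s) * W * ((levyMass (μ.restrict Sᶜ) ρ).toReal * ∫ x, |ψ x|)
        + (t - s) ^ 2 * W * (levyMass μ ρ).toReal * (A * ∫ x, |symLevy (μ.restrict S) ψ x|) := by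
  have := hμ.sFinite
  have : IsFiniteMeasure (μ.restrict S) := isFiniteMeasure_restrict.2 hμS
  have h0 : 0 ≤ t - s := by linarith
  have hsT : s ∈ Icc 0 T := ⟨hs, hst.trans ht⟩
  have hRS : ∀ᵐ z ∂μ.restrict S, ‖z‖ ≤ R := (ae_restrict_iff' hS).2 (ae_of_all _ hR)
  set ν := μ.restrict S with hν
  set g := symLevy ν ψ with hgdef
  have hg : Continuous g := continuous_symLevy hψ hcψ
  have hcg : HasCompactSupport g := hasCompactSupport_symLevy hRS hcψ
  set q : Euc N → ℝ := fun y => a y * g y with hq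
  have hqc : Continuous q := ha.mul hg
  have hcq : HasCompactSupport q := hcg.mul_left
  have hmψ := isTestFn_mollify hρ hψ hcψ
  have hmq := isTestFn_mollify hρ hqc hcq
  have hmg := isTestFn_mollify hρ hg hcg
  have hLρ := hρ.levyMass_ne_top hμ
  have hLρ' : levyMass (μ.restrict Sᶜ) ρ ≠ ⊤ :=
    ne_top_of_le_ne_top hLρ (lintegral_mono' Measure.restrict_le_self le_rfl)
  have hLψ' := levyMass_mollify_ne_top hρ.continuous hψ hcψ hLρ'
  have hWs := ae_mono (slab_le (N := N) hs ht) hW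
  have hri : Integrable (symLevy (μ.restrict Sᶜ) (mollify ρ ψ)) :=
    integrable_symLevy hmψ.continuous hLψ'
  have iw : ∀ {k : Euc N → ℝ}, Integrable k →
      Integrable (fun p : Euc N × ℝ => (φ (u p.1 p.2) - φ C) * k p.1) (slab N s t) := fun hk =>
    (integrable_comp_mul hu (φ := fun r => φ r - φ C) (hφ.sub continuous_const)
      hk).mono_measure (slab_le hs ht)
  have iv : Integrable (fun p : Euc N × ℝ => (u p.1 p.2 - C) * mollify ρ q p.1) (slab N s t) :=
    (integrable_comp_mul hu (φ := fun r => r - C) (by fun_prop)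
      hmq.integrable).mono_measure (slab_le hs ht)
  have hVs : ∀ {k : Euc N → ℝ}, IsTestFn k → Integrable (fun x => (u x s - C) * k x) := fun hk => by
    simp only [sub_mul]
    exact (huC.integrable_mul hk.continuous hk.2 hsT).sub (hk.integrable.const_mul C)
  have e1 : ∫ x, (u x s - C) * mollify ρ (fun y => ψ y + (t - s) * q y) x
      = (∫ x, (u x s - C) * mollify ρ ψ x) + (t - s) * ∫ x, (u x s - C) * mollify ρ q x := by
    rw [← integral_const_mul, ← integral_add (hVs hmψ) ((hVs hmq).const_mul _)]
    refine integral_congr_ae (ae_of_all _ fun x => ?_)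
    beta_reduce
    rw [mollify_add_const_mul hρ hψ hqc]
    ring
  have e2 : ∫ p, (φ (u p.1 p.2) - φ C) * symLevy μ (mollify ρ ψ) p.1 ∂slab N s t
      = (∫ p, (φ (u p.1 p.2) - φ C) * mollify ρ g p.1 ∂slab N s t)
        + ∫ p, (φ (u p.1 p.2) - φ C) * symLevy (μ.restrict Sᶜ) (mollify ρ ψ) p.1 ∂slab N s t := by
    rw [← integral_add (iw hmg.integrable) (iw hri)]
    refine integral_congr_ae (ae_of_all _ fun p => ?_)
    beta_reduce
    rw [symLevy_eq_add_restrict hmψ hμ hS, symLevy_mollify hρ hψ hcψ]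
    ring
  have b1 : |∫ p, (φ (u p.1 p.2) - φ C) * symLevy (μ.restrict Sᶜ) (mollify ρ ψ) p.1 ∂slab N s t|
      ≤ (t - s) * W * ((levyMass (μ.restrict Sᶜ) ρ).toReal * ∫ x, |ψ x|) := by
    refine (abs_integral_slab_mul_le hst hWs hri).trans ?_
    gcongr
    exact integral_abs_symLevy_mollify_le hρ hψ hcψ hLρ'
  have b2 : |(∫ p, (u p.1 p.2 - C) * mollify ρ q p.1 ∂slab N s t)
        - (t - s) * ∫ x, (u x s - C) * mollify ρ q x|
      ≤ (t - s) ^ 2 * W * (levyMass μ ρ).toReal * (A * ∫ x, |g x|) := by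
    refine (abs_integral_slab_sub_le hT hφ hμ hu huC husol hρ hqc hcq C hW0 hW hs hst ht).trans ?_
    gcongr
    rw [← integral_const_mul]
    refine integral_mono_of_nonneg (ae_of_all _ fun x => abs_nonneg _)
      ((integrable_of_continuous_hasCompactSupport hg hcg).abs.const_mul A)
      (ae_of_all _ fun x => ?_)
    beta_reduce
    rw [hq, abs_mul, abs_of_nonneg (ha0 x)]
    exact mul_le_mul_of_nonneg_right (hA x) (abs_nonneg _)
  have hgabs : Continuous (fun y => |g y|) := hg.abs
  have hcgabs : HasCompactSupport (fun y => |g y|) := hcg.comp_left abs_zero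
  have hgsq : Continuous (fun y => g y ^ 2) := hg.pow 2
  have hcgsq : HasCompactSupport (fun y => g y ^ 2) :=
    hcg.comp_left (g := fun r : ℝ => r ^ 2) (by simp)
  have b3 : |(∫ p, (φ (u p.1 p.2) - φ C) * mollify ρ g p.1 ∂slab N s t)
        - ∫ p, (u p.1 p.2 - C) * mollify ρ q p.1 ∂slab N s t|
      ≤ (t - s) * η * (∫ x, |g x|) + (t - s) * l * (∫ x, g x ^ 2)
        + D ^ 2 / (4 * l) * (∫ p, d p ^ 2 ∂slab N s t) := by
    have j1 : Integrable (fun p : Euc N × ℝ => η * mollify ρ (fun y => |g y|) p.1) (slab N s t) :=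
      integrable_slab_fst ((isTestFn_mollify hρ hgabs hcgabs).integrable.const_mul η)
    have j2 : Integrable (fun p : Euc N × ℝ => l * mollify ρ (fun y => g y ^ 2) p.1) (slab N s t) :=
      integrable_slab_fst ((isTestFn_mollify hρ hgsq hcgsq).integrable.const_mul l)
    have j3 : Integrable (fun p => D ^ 2 / (4 * l) * d p ^ 2) (slab N s t) :=
      (hd.mono_measure (slab_le hs ht)).const_mul _
    have j12 : Integrable (fun p : Euc N × ℝ => η * mollify ρ (fun y => |g y|) p.1
      + l * mollify ρ (fun y => g y ^ 2) p.1) (slab N s t) := j1.add j2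
    have e3 : (t - s) * η * (∫ x, |g x|) + (t - s) * l * (∫ x, g x ^ 2)
        + D ^ 2 / (4 * l) * (∫ p, d p ^ 2 ∂slab N s t)
        = ∫ p, (η * mollify ρ (fun y => |g y|) p.1 + l * mollify ρ (fun y => g y ^ 2) p.1
          + D ^ 2 / (4 * l) * d p ^ 2) ∂slab N s t := by
      rw [integral_add j12 j3, integral_add j1 j2, integral_const_mul, integral_const_mul,
        integral_const_mul, integral_slab_fst hst, integral_slab_fst hst,
        integral_mollify hρ hgabs hcgabs, integral_mollify hρ hgsq hcgsq, hρ1]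
      ring
    rw [e3, ← integral_sub (iw hmg.integrable) iv, ← Real.norm_eq_abs]
    refine norm_integral_le_of_norm_le (j12.add j3) ?_
    filter_upwards [hest] with p hp
    exact abs_mul_mollify_sub_le hρ hρ0 hρ1 ha hg hl hp
  rw [e1, integral_sub_mul_eq_add_slab hT hφ hμ hu huC husol hmψ C hs hst ht, e2]
  rw [abs_le] at b1 b2 b3 ⊢
  constructor <;> linarith [b1.1, b1.2, b2.1, b2.2, b3.1, b3.2]

end Step

section Scheme

variable {N : ℕ} {T : ℝ} {φ : ℝ → ℝ} {μ : Measure (Euc N)} {u0 : Euc N → ℝ}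
  {u : Euc N → ℝ → ℝ} {ρ θ : Euc N → ℝ} {a : ℕ → Euc N → ℝ}

lemma integral_slab_add {f : Euc N × ℝ → ℝ} (hf : Integrable f (QTvol N T)) {r s t : ℝ}
    (hr : 0 ≤ r) (hrs : r ≤ s) (hst : s ≤ t) (ht : t ≤ T) :
    ∫ p, f p ∂slab N r s + ∫ p, f p ∂slab N s t = ∫ p, f p ∂slab N r t := by
  have hi : ∀ {r t}, 0 ≤ r → r ≤ t → t ≤ T →
      IntervalIntegrable (fun τ => ∫ x, f (x, τ)) volume r t := fun hr hrt ht => by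
    rw [intervalIntegrable_iff_integrableOn_Ioo_of_le hrt]
    exact Integrable.integral_prod_right (hf.mono_measure (slab_le hr ht))
  have hs := hr.trans hrs
  have hsT := hst.trans ht
  rw [integral_slab hrs (hf.mono_measure (slab_le hr hsT)),
    integral_slab hst (hf.mono_measure (slab_le hs ht)),
    integral_slab (hrs.trans hst) (hf.mono_measure (slab_le hr ht))]
  exact intervalIntegral.integral_add_adjacent_intervals (hi hr hrs hsT) (hi hs hst ht)

/-- The error of the dual scheme with mollified, truncated operator. -/
lemma abs_scheme_le (hT : 0 < T) (hφ : Continuous φ) (hμ : IsLevyMeasure μ)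
    (hu : MemLinfQT T u) (huC : MemCL1loc T u) (husol : IsDistSolOp T (Lop μ) φ u0 u)
    (hρ : IsTestFn ρ) (hρ0 : ∀ x, 0 ≤ ρ x) (hρ1 : ∫ x, ρ x = 1)
    (hθ : Continuous θ) (hcθ : HasCompactSupport θ) {B : ℝ} (hB : ∀ x, |θ x| ≤ B)
    (ha : ∀ n, Continuous (a n)) {κ : ℝ} (hκ : 0 < κ) (haκ : ∀ n x, κ ≤ a n x)
    {A : ℝ} (hA : ∀ n x, a n x ≤ A) {S : Set (Euc N)} (hS : MeasurableSet S) (hμS : μ S ≠ ⊤)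
    {R : ℝ} (hR : ∀ z ∈ S, ‖z‖ ≤ R)
    (C : ℝ) {W : ℝ} (hW0 : 0 ≤ W) (hW : ∀ᵐ p ∂QTvol N T, |φ (u p.1 p.2) - φ C| ≤ W)
    {h : ℝ} (hh : 0 ≤ h) {n : ℕ} (hn : n * h ≤ T) (hcfl : h * A * (2 * μ.real S) ≤ 1)
    {η D l : ℝ} (hη : 0 ≤ η) (hl : 0 < l)
    {d : Euc N × ℝ → ℝ} (hd : Integrable (fun p => d p ^ 2) (QTvol N T))
    (hest : ∀ j < n, ∀ᵐ p ∂slab N (n * h - (j + 1) * h) (n * h - j * h), ∀ y, ρ y ≠ 0 →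
      |φ (u p.1 p.2) - φ C - a j (p.1 - y) * (u p.1 p.2 - C)| ≤ η + D * |d p|) :
    |(∫ x, (u x (n * h) - C) * mollify ρ θ x)
        - ∫ x, (u x 0 - C) * mollify ρ (dualSeq (μ.restrict S) h a θ n) x|
      ≤ T * η * (∫ x, |symLevy (μ.restrict S) θ x|)
        + l * (B * (∫ x, |symLevy (μ.restrict S) θ x|) / κ)
        + D ^ 2 / (4 * l) * (∫ p, d p ^ 2 ∂QTvol N T)
        + T * W * ((levyMass (μ.restrict Sᶜ) ρ).toReal *
          ((∫ x, |θ x|) + T * A * ∫ x, |symLevy (μ.restrict S) θ x|))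
        + T * h * (W * (levyMass μ ρ).toReal * (A * ∫ x, |symLevy (μ.restrict S) θ x|)) := by
  have : IsFiniteMeasure (μ.restrict S) := isFiniteMeasure_restrict.2 hμS
  have hRS : ∀ᵐ z ∂μ.restrict S, ‖z‖ ≤ R := (ae_restrict_iff' hS).2 (ae_of_all _ hR)
  have ha0 : ∀ n x, 0 ≤ a n x := fun n x => hκ.le.trans (haκ n x)
  have hA0 : 0 ≤ A := (ha0 0 0).trans (hA 0 0)
  have hν : (μ.restrict S).real univ = μ.real S := by simp [Measure.real]
  have hcfl2 : ∀ n x, h * a n x * (2 * (μ.restrict S).real univ) ≤ 1 := fun n x => by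
    rw [hν]
    refine le_trans ?_ hcfl
    have := hA n x
    gcongr
  have hcfl1 : ∀ n x, h * a n x * (μ.restrict S).real univ ≤ 1 := fun n x => by
    refine le_trans ?_ (hcfl2 n x)
    have h1 : 0 ≤ h * a n x := mul_nonneg hh (ha0 n x)
    have h2 : 0 ≤ (μ.restrict S).real univ := measureReal_nonneg
    nlinarith
  set ν := μ.restrict S
  set G := ∫ x, |symLevy ν θ x| with hG
  have hG0 : 0 ≤ G := integral_nonneg fun x => abs_nonneg _
  set r := (levyMass (μ.restrict Sᶜ) ρ).toReal
  set L := (levyMass μ ρ).toReal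
  have hr0 : 0 ≤ r := ENNReal.toReal_nonneg
  have hL0 : 0 ≤ L := ENNReal.toReal_nonneg
  set ψ := dualSeq ν h a θ with hψdef
  set b := (∫ x, |θ x|) + T * A * G with hb
  have key : ∀ m : ℕ, m ≤ n →
      |(∫ x, (u x (n * h) - C) * mollify ρ θ x)
        - ∫ x, (u x (n * h - m * h) - C) * mollify ρ (ψ m) x|
      ≤ m * h * η * G + h * l * (∑ i ∈ Finset.range m, ∫ x, symLevy ν (ψ i) x ^ 2)
        + D ^ 2 / (4 * l) * (∫ p, d p ^ 2 ∂slab N (n * h - m * h) (n * h))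
        + m * h * W * (r * b) + m * h * h * (W * L * (A * G)) := by
    intro m
    induction m with
    | zero => intro _; simp [hψdef, dualSeq, slab]
    | succ m ih =>
      intro hm
      have hm' : (m : ℝ) + 1 ≤ n := by exact_mod_cast hm
      have ih := ih (by omega)
      obtain ⟨hc, hcc⟩ := dualSeq_continuous_hasCompactSupport (h := h) hRS ha hθ hcθ m
      have e0 : n * h - m * h - (n * h - (m + 1) * h) = h := by ring
      have hs : 0 ≤ n * h - (m + 1) * h := by nlinarith
      have hst : n * h - (m + 1) * h ≤ n * h - m * h := by nlinarith
      have htn : n * h - m * h ≤ n * h := by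
        have : 0 ≤ (m : ℝ) * h := by positivity
        linarith
      have step := abs_step_le hT hφ hμ hu huC husol hρ hρ0 hρ1 hc hcc (ha m) (ha0 m) (hA m) hS
        hμS hR C hW0 hW hs hst (htn.trans hn) hl hd (hest m (by omega))
      rw [e0] at step
      have g1 := integral_abs_symLevy_dualSeq_le (h := h) hRS ha hθ hcθ ha0 hh hcfl1 m
      have g2 := integral_abs_dualSeq_le (h := h) hRS ha hθ hcθ ha0 hh hcfl1 hA m
      have g3 : ∫ x, |ψ m x| ≤ b := by
        refine g2.trans ?_
        have : (m : ℝ) * h ≤ T := by nlinarith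
        rw [hb]
        gcongr
      have e1 : h * η * (∫ x, |symLevy ν (ψ m) x|) ≤ h * η * G := by gcongr
      have e2 : h * W * (r * ∫ x, |ψ m x|) ≤ h * W * (r * b) := by gcongr
      have e3 : h ^ 2 * W * L * (A * ∫ x, |symLevy ν (ψ m) x|) ≤ h ^ 2 * W * L * (A * G) := by
        gcongr
      have e4 := integral_slab_add hd hs hst htn hn
      have tri := abs_sub_le (∫ x, (u x (n * h) - C) * mollify ρ θ x)
        (∫ x, (u x (n * h - m * h) - C) * mollify ρ (ψ m) x)
        (∫ x, (u x (n * h - (m + 1) * h) - C) * mollify ρ (ψ (m + 1)) x)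
      push_cast
      rw [Finset.sum_range_succ, ← e4]
      refine tri.trans ((add_le_add ih step).trans ?_)
      linarith
  have hfin := key n le_rfl
  rw [sub_self] at hfin
  refine hfin.trans ?_
  obtain ⟨hc, hcc⟩ := dualSeq_continuous_hasCompactSupport (h := h) hRS ha hθ hcθ n
  have en := sum_integral_sq_symLevy_dualSeq_le (h := h) hRS ha hθ hcθ hκ.le haκ hh hcfl2 n
  have en1 := integral_mul_symLevy_self_nonpos (ν := ν) hc hcc
  have en2 : -(∫ x, θ x * symLevy ν θ x) ≤ B * G := by
    have hLc := continuous_symLevy (ν := ν) hθ hcθ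
    have i1 : Integrable (fun x => θ x * symLevy ν θ x) := by
      simpa only [id] using integrable_mul_comp hθ hcθ hLc continuous_id
    have i2 := (integrable_of_continuous_hasCompactSupport hLc
      (hasCompactSupport_symLevy hRS hcθ)).abs
    rw [hG, ← integral_const_mul, ← integral_neg]
    refine integral_mono i1.neg (i2.const_mul B) fun x => (neg_le_abs _).trans ?_
    rw [abs_mul]
    exact mul_le_mul_of_nonneg_right (hB x) (abs_nonneg _)
  have en3 : h * (∑ i ∈ Finset.range n, ∫ x, symLevy ν (ψ i) x ^ 2) ≤ B * G / κ := by
    rw [le_div_iff₀ hκ]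
    linarith
  have e5 : ∫ p, d p ^ 2 ∂slab N 0 (n * h) ≤ ∫ p, d p ^ 2 ∂QTvol N T :=
    integral_mono_measure (slab_le le_rfl hn) (ae_of_all _ fun p => sq_nonneg _) hd
  have hb0 : 0 ≤ b := by
    have : 0 ≤ ∫ x, |θ x| := integral_nonneg fun x => abs_nonneg _
    positivity
  have e6 : h * l * (∑ i ∈ Finset.range n, ∫ x, symLevy ν (ψ i) x ^ 2) ≤ l * (B * G / κ) := by
    have := mul_le_mul_of_nonneg_left en3 hl.le
    linarith
  gcongr

end Scheme

/-- A continuous bounded nonnegative approximation of the difference quotient of `φ` at `C`. -/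
lemma exists_coefficient {φ : ℝ → ℝ} (hφ : Continuous φ) (hφm : Monotone φ) (C : ℝ) {M : ℝ}
    (hM : 0 ≤ M) {η : ℝ} (hη : 0 < η) :
    ∃ F : ℝ → ℝ, ∃ A D : ℝ, Continuous F ∧ 0 ≤ D ∧ (∀ s, 0 ≤ F s) ∧ (∀ s, F s ≤ A) ∧
      (∀ s, |s| ≤ M → |φ s - φ C - F s * (s - C)| ≤ η) ∧
      ∀ s r, |F s - F r| ≤ η + D * |s - r| := by
  obtain ⟨W, hW⟩ := (isCompact_Icc (a := -M) (b := M)).exists_bound_of_continuousOn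
    (f := fun s => φ s - φ C) (by fun_prop)
  have hW0 : 0 ≤ W := (norm_nonneg _).trans (hW 0 ⟨by linarith, hM⟩)
  obtain ⟨δ, hδ, hδφ⟩ := Metric.continuous_iff.1 hφ C η hη
  set ε := η * δ ^ 2 / (W + 1) with hε
  have hε0 : 0 < ε := by positivity
  set F0 : ℝ → ℝ := fun s => (s - C) * (φ s - φ C) / ((s - C) ^ 2 + ε) with hF0
  have hden : ∀ s, 0 < (s - C) ^ 2 + ε := fun s => by positivity
  have hF0c : Continuous F0 := by
    refine Continuous.div (by fun_prop) (by fun_prop) fun s => (hden s).ne'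
  have hF00 : ∀ s, 0 ≤ F0 s := fun s => by
    refine div_nonneg ?_ (hden s).le
    rcases le_total s C with h | h
    · exact mul_nonneg_of_nonpos_of_nonpos (by linarith) (by linarith [hφm h])
    · exact mul_nonneg (by linarith) (by linarith [hφm h])
  have hF0err : ∀ s, |s| ≤ M → |φ s - φ C - F0 s * (s - C)| ≤ η := fun s hs => by
    have e : φ s - φ C - F0 s * (s - C) = (φ s - φ C) * (ε / ((s - C) ^ 2 + ε)) := by
      have := (hden s).ne'
      simp only [hF0]
      field_simp
      ring
    have hq0 : 0 ≤ ε / ((s - C) ^ 2 + ε) := div_nonneg hε0.le (hden s).le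
    rw [e, abs_mul, abs_of_nonneg hq0]
    by_cases hsC : |s - C| < δ
    · have h1 : |φ s - φ C| ≤ η := (hδφ s hsC).le
      have h2 : ε / ((s - C) ^ 2 + ε) ≤ 1 := by
        rw [div_le_one (hden s)]
        nlinarith [sq_nonneg (s - C)]
      nlinarith
    · have h1 : |φ s - φ C| ≤ W := hW s (abs_le.1 hs)
      have h2 : ε / ((s - C) ^ 2 + ε) ≤ ε / δ ^ 2 := by
        have : δ ^ 2 ≤ (s - C) ^ 2 := by
          rw [← sq_abs (s - C)]
          have := not_lt.1 hsC
          gcongr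
        gcongr
        linarith
      calc |φ s - φ C| * (ε / ((s - C) ^ 2 + ε)) ≤ W * (ε / δ ^ 2) := by gcongr
        _ = η * (W / (W + 1)) := by
          rw [hε]
          field_simp
        _ ≤ η * 1 := by
          gcongr
          rw [div_le_one (by positivity)]
          linarith
        _ = η := mul_one _
  set cl : ℝ → ℝ := fun s => max (-M) (min M s) with hcl
  have hclc : Continuous cl := by fun_prop
  have hclm : ∀ s, cl s ∈ Icc (-M) M := fun s =>
    ⟨le_max_left _ _, max_le (by linarith) (min_le_left _ _)⟩
  have hcle : ∀ s, |s| ≤ M → cl s = s := fun s hs => by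
    rw [abs_le] at hs
    simp [hcl, hs.1, hs.2]
  have hclL : ∀ s r, |cl s - cl r| ≤ |s - r| := fun s r => by
    refine (abs_max_sub_max_le_max (-M) (min M s) (-M) (min M r)).trans (max_le (by simp) ?_)
    exact (abs_min_sub_min_le_max M s M r).trans (max_le (by simp) le_rfl)
  obtain ⟨A, hA⟩ := (isCompact_Icc (a := -M) (b := M)).exists_bound_of_continuousOn
    hF0c.continuousOn
  have hA' : ∀ s, F0 (cl s) ≤ A := fun s => (le_abs_self _).trans (hA _ (hclm s))
  have hA0 : 0 ≤ A := (hF00 _).trans (hA' 0)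
  obtain ⟨δ', hδ', hu⟩ := Metric.uniformContinuousOn_iff.1
    (isCompact_Icc.uniformContinuousOn_of_continuous (hF0c.continuousOn (s := Icc (-M) M))) η hη
  refine ⟨fun s => F0 (cl s), A, A / δ', hF0c.comp hclc, by positivity, fun s => hF00 _, hA',
    fun s hs => by simpa only [hcle s hs] using hF0err s hs, fun s r => ?_⟩
  by_cases hsr : |cl s - cl r| < δ'
  · have := (hu _ (hclm s) _ (hclm r) hsr).le
    rw [Real.dist_eq] at this
    have h2 : 0 ≤ A / δ' * |s - r| := by positivity
    linarith
  · have h1 : δ' ≤ |s - r| := (not_lt.1 hsr).trans (hclL s r)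
    have h2 : |F0 (cl s) - F0 (cl r)| ≤ A := by
      rw [abs_le]
      constructor <;> linarith [hF00 (cl s), hF00 (cl r), hA' s, hA' r]
    have h3 : A ≤ A / δ' * |s - r| := by
      calc A = A / δ' * δ' := by field_simp
        _ ≤ _ := by gcongr
    linarith

section Approximation

variable {N : ℕ} {T : ℝ} {u : Euc N → ℝ → ℝ} {θ : Euc N → ℝ}

lemma exists_uniform_continuous_approx (hu : MemLinfQT T u) (hu1 : MemL1QT T u) {ε : ℝ}
    (hε : 0 < ε) : ∃ c : Euc N × ℝ → ℝ, UniformContinuous c ∧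
      Integrable (fun p => (u p.1 p.2 - c p) ^ 2) (QTvol N T) ∧
      ∫ p, (u p.1 p.2 - c p) ^ 2 ∂QTvol N T ≤ ε := by
  obtain ⟨M, hM⟩ := hu.2
  have h2 : MemLp (fun p : Euc N × ℝ => u p.1 p.2) (ENNReal.ofReal 2) (QTvol N T) := by
    rw [ENNReal.ofReal_ofNat, memLp_two_iff_integrable_sq hu.1]
    simp only [pow_two]
    exact Integrable.mul_bdd (c := M) hu1 hu.1 hM
  have : (QTvol N T).Regular := by unfold QTvol; infer_instance
  obtain ⟨c, hcc, hc, hcont, hcL⟩ := h2.exists_hasCompactSupport_integral_rpow_sub_le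
    (by norm_num) hε
  have hcL' := h2.sub hcL
  rw [ENNReal.ofReal_ofNat, memLp_two_iff_integrable_sq hcL'.1] at hcL'
  refine ⟨c, hcc.uniformContinuous_of_continuous hcont, hcL', ?_⟩
  simpa using hc

lemma exists_mollify_error_le {v : Euc N → ℝ} (hv : LocallyIntegrable v) (hθ : Continuous θ)
    (hcθ : HasCompactSupport θ) {ε : ℝ} (hε : 0 < ε) :
    ∃ δ > 0, ∀ ρ : Euc N → ℝ, IsTestFn ρ → (∀ x, 0 ≤ ρ x) → ∫ x, ρ x = 1 →
      (∀ x, ρ x ≠ 0 → ‖x‖ < δ) →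
      |(∫ x, v x * mollify ρ θ x) - ∫ x, v x * θ x| ≤ ε := by
  set K := Metric.cthickening 1 (tsupport θ)
  have hK : IsCompact K := hcθ.isCompact.cthickening
  have hvK : IntegrableOn v K := hv.integrableOn_isCompact hK
  set I := ∫ x in K, |v x|
  have hI : 0 ≤ I := integral_nonneg fun x => abs_nonneg _
  have hω : 0 < ε / (I + 1) := by positivity
  obtain ⟨δ, hδ, hu⟩ := Metric.uniformContinuous_iff.1
    (hcθ.uniformContinuous_of_continuous hθ) _ hω
  refine ⟨min δ 1, by positivity, fun ρ hρ hρ0 hρ1 hρδ => ?_⟩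
  have hm := isTestFn_mollify hρ hθ hcθ
  have hi : ∀ {k : Euc N → ℝ}, Continuous k → HasCompactSupport k →
      Integrable (fun x => v x * k x) := fun hk hck =>
    by simpa [mul_comm] using hv.integrable_smul_left_of_hasCompactSupport hk hck
  have hsub : ∀ x, x ∉ K → v x * mollify ρ θ x - v x * θ x = 0 := fun x hx => by
    have h1 : θ x = 0 := image_eq_zero_of_notMem_tsupport fun h =>
      hx (Metric.self_subset_cthickening _ h)
    have h2 : mollify ρ θ x = 0 := by
      refine integral_eq_zero_of_ae (ae_of_all _ fun y => ?_)
      by_cases hy : ρ y = 0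
      · simp [hy]
      have : θ (x - y) = 0 := image_eq_zero_of_notMem_tsupport fun h => hx (by
        refine Metric.mem_cthickening_of_dist_le x (x - y) 1 _ h ?_
        simpa using ((hρδ y hy).trans_le (min_le_right _ _)).le)
      simp [this]
    simp [h1, h2]
  rw [← integral_sub (hi hm.continuous hm.2) (hi hθ hcθ),
    ← setIntegral_eq_integral_of_forall_compl_eq_zero hsub]
  calc |∫ x in K, (v x * mollify ρ θ x - v x * θ x)| ≤ ∫ x in K, |v x| * (ε / (I + 1)) := by
        rw [← Real.norm_eq_abs]
        refine norm_integral_le_of_norm_le (hvK.abs.mul_const _) (ae_of_all _ fun x => ?_)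
        rw [← mul_sub, norm_mul]
        refine mul_le_mul_of_nonneg_left ?_ (norm_nonneg _)
        refine abs_mollify_sub_le hρ hρ0 hρ1 hθ x fun y hy => (hu ?_).le
        simpa using (hρδ y hy).trans_le (min_le_left _ _)
    _ = I / (I + 1) * ε := by rw [integral_mul_const]; ring
    _ ≤ 1 * ε := by
      gcongr
      rw [div_le_one (by positivity)]
      linarith
    _ = ε := one_mul _

end Approximation

section DualApprox

variable {N : ℕ} {T : ℝ} {φ : ℝ → ℝ} {μ : Measure (Euc N)} {u0 : Euc N → ℝ}
  {u : Euc N → ℝ → ℝ} {θ : Euc N → ℝ}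

lemma abs_sub_coefficient_mul_le {φ F : ℝ → ℝ} {C M K η D ω s c c' : ℝ} (hη : 0 ≤ η) (hD : 0 ≤ D)
    (hF : ∀ s, |s| ≤ M → |φ s - φ C - F s * (s - C)| ≤ η)
    (hFL : ∀ s r, |F s - F r| ≤ η + D * |s - r|) (hs : |s| ≤ M) (hK : |s - C| ≤ K)
    (hω : D * ω ≤ η) (hc : |c - c'| ≤ ω) :
    |φ s - φ C - (F c' + η) * (s - C)| ≤ η * (1 + 4 * K) + D * K * |s - c| := by
  have hK0 : 0 ≤ K := (abs_nonneg _).trans hK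
  have h1 := hF s hs
  have h2 : |(F s - F c) * (s - C)| ≤ (η + D * |s - c|) * K := by
    rw [abs_mul]
    have := hFL s c
    gcongr
  have h3 : |(F c - F c') * (s - C)| ≤ (η + η) * K := by
    rw [abs_mul]
    have h := hFL c c'
    have h' := mul_le_mul_of_nonneg_left hc hD
    gcongr
    linarith
  have h4 : |η * (s - C)| ≤ η * K := by
    rw [abs_mul, abs_of_nonneg hη]
    gcongr
  have e : φ s - φ C - (F c' + η) * (s - C) = (φ s - φ C - F s * (s - C)) + (F s - F c) * (s - C)
      + (F c - F c') * (s - C) - η * (s - C) := by ring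
  rw [abs_le] at *
  constructor <;> nlinarith

/-- Up to a small error, testing `u(·,t) - C` against `θ` amounts to testing `u0 - C` against a test
function with the same bound and sign as `θ`. -/
lemma exists_dual_approx (hT : 0 < T) (hφ : Continuous φ) (hφm : Monotone φ)
    (hμ : IsLevyMeasure μ) (hu0 : Integrable u0) (hu : MemLinfQT T u) (hu1 : MemL1QT T u)
    (huC : MemCL1loc T u) (husol : IsDistSolOp T (Lop μ) φ u0 u) (hθ : IsTestFn θ) {B : ℝ}
    (hB : ∀ x, |θ x| ≤ B) {t : ℝ} (ht : t ∈ Icc 0 T) (C : ℝ) {ε : ℝ} (hε : 0 < ε) :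
    ∃ P : Euc N → ℝ, IsTestFn P ∧ (∀ x, |P x| ≤ B) ∧ ((∀ x, 0 ≤ θ x) → ∀ x, 0 ≤ P x) ∧
      |(∫ x, (u x t - C) * θ x) - ∫ x, (u0 x - C) * P x| ≤ ε := by
  have := hμ.sFinite
  rcases ht.1.eq_or_lt with rfl | ht0
  · exact ⟨θ, hθ, hB, id, by
      rw [integral_sub_mul_zero hT hφ hμ hu0 hu huC husol hθ C]; simpa using hε.le⟩
  have hB0 : 0 ≤ B := (abs_nonneg _).trans (hB 0)
  obtain ⟨M, hM0, hM⟩ := hu.exists_abs_comp_le (φ := fun s => s) continuous_id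
  obtain ⟨W, hW0, hW⟩ := hu.exists_abs_comp_le (φ := fun s => φ s - φ C) (by fun_prop)
  set K := M + |C| with hK
  have hK0 : 0 ≤ K := by positivity
  set g := (levyMass μ θ).toReal with hg
  have hg0 : 0 ≤ g := ENNReal.toReal_nonneg
  have hG : ∀ S : Set (Euc N), ∫ x, |symLevy (μ.restrict S) θ x| ≤ g := fun S => by
    have h1 : levyMass (μ.restrict S) θ ≤ levyMass μ θ :=
      lintegral_mono' Measure.restrict_le_self le_rfl
    have h2 := hθ.levyMass_ne_top hμ
    exact (integral_abs_symLevy_le hθ.continuous (ne_top_of_le_ne_top h2 h1)).trans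
      (ENNReal.toReal_mono h2 h1)
  have he : 0 < ε / 6 := by positivity
  obtain ⟨η, hη, hηe⟩ := exists_pos_mul_lt he (T * (1 + 4 * K) * g)
  obtain ⟨F, A, D, hFc, hD, hF0, hFA, hFerr, hFL⟩ := exists_coefficient hφ hφm C hM0 hη
  have hA0 : 0 ≤ A := (hF0 0).trans (hFA 0)
  obtain ⟨l, hl, hle⟩ := exists_pos_mul_lt he (B * g / η)
  obtain ⟨ε', hε', hε'e⟩ := exists_pos_mul_lt he ((D * K) ^ 2 / (4 * l))
  obtain ⟨c, hc, hci, hcε⟩ := exists_uniform_continuous_approx hu hu1 hε'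
  obtain ⟨ω, hω, hωη⟩ := exists_pos_mul_lt hη D
  obtain ⟨δ₁, hδ₁, hcδ⟩ := Metric.uniformContinuous_iff.1 hc ω hω
  have hv : LocallyIntegrable (fun x => u x t - C) := by
    rw [locallyIntegrable_iff]
    exact fun k hk => ((huC k hk).1 t ht).sub (integrableOn_const hk.measure_ne_top)
  obtain ⟨δ₂, hδ₂, hθδ⟩ := exists_mollify_error_le hv hθ.continuous hθ.2 he
  obtain ⟨ρ, hρ, hρ0, hρ1, hρδ⟩ := exists_mollifier N (lt_min hδ₁ hδ₂)
  have hmol := hθδ ρ hρ hρ0 hρ1 fun x hx => (hρδ x hx).trans_le (min_le_right _ _)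
  obtain ⟨r, hr, hre⟩ := exists_pos_mul_lt he (T * W * ((∫ x, |θ x|) + T * (A + η) * g))
  obtain ⟨S, hS, hμS, ⟨R, hR⟩, hSr⟩ := hρ.exists_truncation hμ (ENNReal.ofReal_pos.2 hr)
  have hSr' := ENNReal.toReal_le_of_le_ofReal hr.le hSr
  obtain ⟨h₁, hh₁, hh₁e⟩ := exists_pos_mul_lt zero_lt_one ((A + η) * (2 * μ.real S))
  obtain ⟨h₂, hh₂, hh₂e⟩ := exists_pos_mul_lt he
    (T * (W * (levyMass μ ρ).toReal * ((A + η) * g)))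
  have hh₀ : 0 < min δ₁ (min h₁ h₂) := by positivity
  obtain ⟨n, hn⟩ := exists_nat_gt (t / min δ₁ (min h₁ h₂))
  have hn0 : (0 : ℝ) < n := (by positivity : (0 : ℝ) ≤ _).trans_lt hn
  set h := t / n with hh
  have hh0 : 0 < h := by positivity
  have hnh : n * h = t := by rw [hh]; field_simp
  have hhlt : h < min δ₁ (min h₁ h₂) := by
    rw [hh, div_lt_iff₀ hn0]
    rwa [div_lt_iff₀ hh₀, mul_comm] at hn
  have hhδ : h < δ₁ := hhlt.trans_le (min_le_left _ _)
  have hhh₁ : h ≤ h₁ := hhlt.le.trans ((min_le_right _ _).trans (min_le_left _ _))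
  have hhh₂ : h ≤ h₂ := hhlt.le.trans ((min_le_right _ _).trans (min_le_right _ _))
  set a : ℕ → Euc N → ℝ := fun j x => F (c (x, n * h - j * h)) + η with ha
  have hac : ∀ j, Continuous (a j) := fun j => by
    have := hc.continuous
    fun_prop
  have haη : ∀ j x, η ≤ a j x := fun j x => by simpa [ha] using hF0 _
  have ha0 : ∀ j x, 0 ≤ a j x := fun j x => hη.le.trans (haη j x)
  have haA : ∀ j x, a j x ≤ A + η := fun j x => by simpa [ha] using hFA _
  have hcfl : h * (A + η) * (2 * μ.real S) ≤ 1 := by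
    have : (A + η) * (2 * μ.real S) * h ≤ (A + η) * (2 * μ.real S) * h₁ := by gcongr
    linarith
  have hest : ∀ j < n, ∀ᵐ p ∂slab N (n * h - (j + 1) * h) (n * h - j * h), ∀ y, ρ y ≠ 0 →
      |φ (u p.1 p.2) - φ C - a j (p.1 - y) * (u p.1 p.2 - C)|
        ≤ η * (1 + 4 * K) + D * K * |u p.1 p.2 - c p| := fun j hj => by
    have hs : 0 ≤ n * h - (j + 1) * h := by
      have : ((j : ℝ) + 1) ≤ n := by exact_mod_cast hj
      nlinarith
    have hs' : n * h - j * h ≤ T := by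
      have : 0 ≤ j * h := by positivity
      linarith [ht.2]
    have hmem : ∀ᵐ p ∂slab N (n * h - (j + 1) * h) (n * h - j * h),
        p ∈ (univ : Set (Euc N)) ×ˢ Ioo (n * h - (j + 1) * h) (n * h - j * h) := by
      rw [slab_eq_restrict hs hs']
      exact ae_restrict_mem (MeasurableSet.univ.prod measurableSet_Ioo)
    filter_upwards [ae_mono (slab_le hs hs') hM, hmem] with p hp hpm y hy
    refine abs_sub_coefficient_mul_le hη.le hD hFerr hFL hp ?_ hωη.le (hcδ ?_).le
    · exact (abs_sub _ _).trans (add_le_add hp le_rfl)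
    · rw [Prod.dist_eq, max_lt_iff]
      constructor
      · simpa [dist_eq_norm] using (hρδ y hy).trans_le (min_le_left _ _)
      · have := hpm.2
        rw [Real.dist_eq, abs_lt]
        constructor <;> linarith [this.1, this.2]
  have key := abs_scheme_le hT hφ hμ hu huC husol hρ hρ0 hρ1 hθ.continuous hθ.2 hB hac hη haη haA
    hS hμS hR C hW0 hW hh0.le (hnh.le.trans ht.2) hcfl
    (by positivity : 0 ≤ η * (1 + 4 * K)) hl hci hest
  have hfin : IsFiniteMeasure (μ.restrict S) := ⟨by simpa using hμS.lt_top⟩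
  have hRae : ∀ᵐ z ∂μ.restrict S, ‖z‖ ≤ R := (ae_restrict_mem hS).mono hR
  have hcfl' : ∀ j x, h * a j x * (μ.restrict S).real univ ≤ 1 := fun j x => by
    rw [measureReal_restrict_apply_univ]
    have h1 : h * a j x * μ.real S ≤ h * (A + η) * μ.real S := by gcongr; exact haA j x
    have h2 : 0 ≤ h * (A + η) * μ.real S := by positivity
    linarith
  obtain ⟨hψ, hcψ⟩ := dualSeq_continuous_hasCompactSupport (h := h) hRae hac hθ.continuous hθ.2 n
  have hψB : ∀ x, |dualSeq (μ.restrict S) h a θ n x| ≤ B := fun x => abs_le.2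
    ⟨le_dualSeq hRae hac hθ.continuous hθ.2 ha0 hh0.le hcfl' (fun x => (abs_le.1 (hB x)).1) n x,
      dualSeq_le hRae hac hθ.continuous hθ.2 ha0 hh0.le hcfl' (fun x => (abs_le.1 (hB x)).2) n x⟩
  have hP := isTestFn_mollify hρ hψ hcψ
  refine ⟨_, hP, abs_mollify_le hρ hρ0 hρ1 hψ hψB, fun hθ0 => mollify_nonneg hρ0
    (le_dualSeq hRae hac hθ.continuous hθ.2 ha0 hh0.le hcfl' hθ0 n), ?_⟩
  rw [hnh, integral_sub_mul_zero hT hφ hμ hu0 hu huC husol hP C] at key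
  have hGS := hG S
  have hGS0 : 0 ≤ ∫ x, |symLevy (μ.restrict S) θ x| := integral_nonneg fun x => abs_nonneg _
  generalize (∫ x, |symLevy (μ.restrict S) θ x|) = G at key hGS hGS0
  have hθ1 : 0 ≤ ∫ x, |θ x| := integral_nonneg fun x => abs_nonneg _
  have b1 : T * (η * (1 + 4 * K)) * G ≤ T * (1 + 4 * K) * g * η := by
    calc _ ≤ T * (η * (1 + 4 * K)) * g := by gcongr
      _ = _ := by ring
  have b2 : l * (B * G / η) ≤ B * g / η * l := by
    rw [mul_comm]
    gcongr
  have b3 : (D * K) ^ 2 / (4 * l) * (∫ p, (u p.1 p.2 - c p) ^ 2 ∂QTvol N T)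
      ≤ (D * K) ^ 2 / (4 * l) * ε' := by gcongr
  have b4 : T * W * ((levyMass (μ.restrict Sᶜ) ρ).toReal * ((∫ x, |θ x|) + T * (A + η) * G))
      ≤ T * W * ((∫ x, |θ x|) + T * (A + η) * g) * r := by
    calc _ ≤ T * W * (r * ((∫ x, |θ x|) + T * (A + η) * g)) := by gcongr
      _ = _ := by ring
  have b5 : T * h * (W * (levyMass μ ρ).toReal * ((A + η) * G))
      ≤ T * (W * (levyMass μ ρ).toReal * ((A + η) * g)) * h₂ := by
    calc _ ≤ T * h₂ * (W * (levyMass μ ρ).toReal * ((A + η) * g)) := by gcongr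
      _ = _ := by ring
  rw [abs_le] at *
  constructor <;> linarith

end DualApprox

section Duality

variable {N : ℕ} {v : Euc N → ℝ}

lemma ae_nonpos_of_integral_mul_nonpos (hv : LocallyIntegrable v)
    (h : ∀ θ : Euc N → ℝ, IsTestFn θ → (∀ x, 0 ≤ θ x) → ∫ x, v x * θ x ≤ 0) :
    ∀ᵐ x, v x ≤ 0 := by
  let b : ℕ → ContDiffBump (0 : Euc N) := fun n =>
    ⟨1 / (n + 1) / 2, 1 / (n + 1), by positivity, half_lt_self (by positivity)⟩
  have hb := ContDiffBump.ae_convolution_tendsto_right_of_locallyIntegrable (φ := b) (l := atTop)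
    (K := 2) tendsto_one_div_add_atTop_nhds_zero_nat
    (Eventually.of_forall fun n => by simp only [b]; linarith) hv
  filter_upwards [hb] with x hx
  refine le_of_tendsto' hx fun n => ?_
  rw [convolution_eq_swap]
  have ht : IsTestFn fun y => (b n).normed volume (x - y) :=
    ⟨(b n).contDiff_normed.comp (contDiff_const.sub contDiff_id),
      (b n).hasCompactSupport_normed.comp_homeomorph (Homeomorph.subLeft x)⟩
  refine le_trans (le_of_eq ?_) (h _ ht fun y => (b n).nonneg_normed _)
  exact integral_congr_ae (ae_of_all _ fun y => mul_comm _ _)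

lemma integral_abs_le_of_integral_mul_le (hv : Integrable v) {I : ℝ}
    (h : ∀ θ : Euc N → ℝ, IsTestFn θ → (∀ x, |θ x| ≤ 1) → ∫ x, v x * θ x ≤ I) :
    ∫ x, |v x| ≤ I := by
  refine le_of_forall_pos_le_add fun ε hε => ?_
  have he : 0 < ε / 4 := by positivity
  obtain ⟨w, hcw, hvw, hw, hwi⟩ := hv.exists_hasCompactSupport_integral_sub_le he
  obtain ⟨r, hr, hre⟩ := exists_pos_mul_lt he (volume.real (tsupport w))
  have hden : ∀ x, 0 < |w x| + r := fun x => by positivity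
  set k : Euc N → ℝ := fun x => w x / (|w x| + r) with hk
  have hkc : Continuous k := hw.div (by fun_prop) fun x => (hden x).ne'
  have hck : HasCompactSupport k := hcw.mono fun x hx hwx => hx (by
    have : w x = 0 := hwx
    simp [hk, this])
  have hk1 : ∀ x, |k x| ≤ 1 := fun x => by
    rw [hk, abs_div, abs_of_pos (hden x), div_le_one (hden x)]
    linarith
  obtain ⟨δ, hδ, hδk⟩ := exists_mollify_error_le hv.locallyIntegrable hkc hck he
  obtain ⟨ρ, hρ, hρ0, hρ1, hρδ⟩ := exists_mollifier N hδ
  have h1 := hδk ρ hρ hρ0 hρ1 hρδ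
  have h2 := h _ (isTestFn_mollify hρ hkc hck) (abs_mollify_le hρ hρ0 hρ1 hkc hk1)
  have ib : ∀ {f : Euc N → ℝ}, Integrable f → Integrable fun x => f x * k x := fun hf =>
    hf.mul_bdd (c := 1) hkc.aestronglyMeasurable (ae_of_all _ hk1)
  have iS : Integrable ((tsupport w).indicator fun _ => r) :=
    (integrable_indicator_iff (isClosed_tsupport w).measurableSet).2
      (integrableOn_const hcw.isCompact.measure_ne_top)
  have hd : Integrable (fun x => |v x - w x|) := (hv.sub hwi).abs
  have i1 : Integrable (fun x => v x * k x + 2 * |v x - w x|) := (ib hv).add (hd.const_mul 2)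
  have h3 : ∫ x, |v x| ≤ ∫ x, ((v x * k x + 2 * |v x - w x|)
      + (tsupport w).indicator (fun _ => r) x) := by
    refine integral_mono hv.abs (i1.add iS) fun x => ?_
    have e1 : |w x| ≤ w x * k x + (tsupport w).indicator (fun _ => r) x := by
      by_cases hx : x ∈ tsupport w
      · rw [indicator_of_mem hx]
        have e : w x * k x = |w x| ^ 2 / (|w x| + r) := by rw [hk, sq_abs]; ring
        rw [e, ← sub_le_iff_le_add, le_div_iff₀ (hden x)]
        nlinarith
      · simp [image_eq_zero_of_notMem_tsupport hx, indicator_of_notMem hx]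
    have e2 : |(w x - v x) * k x| ≤ |v x - w x| * 1 := by
      rw [abs_mul, abs_sub_comm]
      exact mul_le_mul_of_nonneg_left (hk1 x) (abs_nonneg _)
    have e3 : |v x| ≤ |v x - w x| + |w x| := by simpa using abs_add_le (v x - w x) (w x)
    have e4 := le_abs_self ((w x - v x) * k x)
    beta_reduce
    linarith
  rw [integral_add i1 iS, integral_add (ib hv) (hd.const_mul 2), integral_const_mul,
    integral_indicator (isClosed_tsupport w).measurableSet, setIntegral_const, smul_eq_mul] at h3
  simp only [Real.norm_eq_abs] at hvw
  have := (abs_le.1 h1).1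
  linarith

end Duality

/-- `L¹` and `L^∞` bounds (Theorem 2.6 (c), (d)).
For every `t ∈ [0,T]`, `‖u(·,t)‖_{L¹} ≤ ‖u₀‖_{L¹}` and `‖u(·,t)‖_{L^∞} ≤ ‖u₀‖_{L^∞}`
(the latter encoded as: every a.e. bound for `|u₀|` is an a.e. bound for `|u(·,t)|`). -/
theorem L1_and_Linfty_bounds
    (N : ℕ) (hN : 0 < N) (T : ℝ) (hT : 0 < T)
    (φ : ℝ → ℝ) (hφc : Continuous φ) (hφm : Monotone φ)
    (μ : Measure (Euc N)) (hμ : IsLevyMeasure μ)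
    (u0 : Euc N → ℝ)
    (hu0inf : MemLinfRn u0) (hu01 : Integrable u0 (volume : Measure (Euc N)))
    (u : Euc N → ℝ → ℝ)
    (huinf : MemLinfQT T u) (hu1 : MemL1QT T u) (huC : MemCL1loc T u)
    (husol : IsDistSolOp T (Lop μ) φ u0 u) :
    ∀ t ∈ Set.Icc (0 : ℝ) T,
      (∫ x, |u x t| ≤ ∫ x, |u0 x|) ∧
      (∀ C : ℝ, (∀ᵐ x : Euc N ∂volume, |u0 x| ≤ C) →
        ∀ᵐ x : Euc N ∂volume, |u x t| ≤ C) := by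
  intro t ht
  have hut : LocallyIntegrable (fun x => u x t) :=
    locallyIntegrable_iff.2 fun k hk => (huC k hk).1 t ht
  have hconst : ∀ C : ℝ, LocallyIntegrable (fun _ : Euc N => C) := locallyIntegrable_const
  constructor
  · by_cases hi : Integrable fun x => u x t
    · refine integral_abs_le_of_integral_mul_le hi fun θ hθ hθ1 => ?_
      refine le_of_forall_pos_le_add fun ε hε => ?_
      obtain ⟨P, hP, hP1, -, hest⟩ := exists_dual_approx hT hφc hφm hμ hu01 huinf hu1 huC husol hθ
        hθ1 ht 0 hε
      simp only [sub_zero] at hest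
      have h1 : ∫ x, u0 x * P x ≤ ∫ x, |u0 x| := by
        refine integral_mono (hu01.mul_bdd (c := 1) hP.continuous.aestronglyMeasurable
          (ae_of_all _ hP1)) hu01.abs fun x => (le_abs_self _).trans ?_
        rw [abs_mul]
        exact mul_le_of_le_one_right (abs_nonneg _) (hP1 x)
      linarith [(abs_le.1 hest).2]
    · rw [integral_undef fun h => hi ?_]
      · exact integral_nonneg fun x => abs_nonneg _
      · refine (integrable_norm_iff ?_).1 h
        exact hut.aestronglyMeasurable
  · intro C hC
    have hup : ∀ᵐ x, u x t - C ≤ 0 := by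
      refine ae_nonpos_of_integral_mul_nonpos (hut.sub (hconst C)) fun θ hθ hθ0 => ?_
      refine le_of_forall_pos_le_add fun ε hε => ?_
      obtain ⟨B, -, hB⟩ := exists_abs_le hθ.continuous hθ.2
      obtain ⟨P, -, -, hP0, hest⟩ := exists_dual_approx hT hφc hφm hμ hu01 huinf hu1 huC husol hθ
        hB ht C hε
      have h1 : ∫ x, (u0 x - C) * P x ≤ 0 := integral_nonpos_of_ae (by
        filter_upwards [hC] with x hx
        exact mul_nonpos_of_nonpos_of_nonneg (by linarith [(abs_le.1 hx).2]) (hP0 hθ0 x))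
      linarith [(abs_le.1 hest).2]
    have hlow : ∀ᵐ x, -C - u x t ≤ 0 := by
      refine ae_nonpos_of_integral_mul_nonpos ((hconst (-C)).sub hut) fun θ hθ hθ0 => ?_
      refine le_of_forall_pos_le_add fun ε hε => ?_
      obtain ⟨B, -, hB⟩ := exists_abs_le hθ.continuous hθ.2
      obtain ⟨P, -, -, hP0, hest⟩ := exists_dual_approx hT hφc hφm hμ hu01 huinf hu1 huC husol hθ
        hB ht (-C) hε
      have h1 : 0 ≤ ∫ x, (u0 x - -C) * P x := integral_nonneg_of_ae (by
        filter_upwards [hC] with x hx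
        exact mul_nonneg (by linarith [(abs_le.1 hx).1]) (hP0 hθ0 x))
      have h2 : ∫ x, (-C - u x t) * θ x = -∫ x, (u x t - -C) * θ x := by
        rw [← integral_neg]
        exact integral_congr_ae (ae_of_all _ fun x => by ring)
      rw [h2]
      linarith [(abs_le.1 hest).1]
    filter_upwards [hup, hlow] with x h1 h2
    exact abs_le.2 ⟨by linarith, by linarith⟩
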